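/- arXiv:2308.01593 — 4 statements merged into one kernel-verified Lean document; each statement's English description precedes it below -/
import Mathlib

section
/- Let q be a prime power, k ≥ 1, and n = 2k. Let a_1, ..., a_{2k} be distinct elements of F_q, A = {a_1, ..., a_{2k}}, and λ = (λ_1, ..., λ_{2k}) with each λ_i ∈ F_q \ {0}. If ∑_{i=1}^{2k} λ_i^2 a_i^j = 0 for every j ∈ {0, 1, ..., 2k-2} ∪ {2k}, then the code C(A, k, λ) is self-dual, i.e., C(A,k,λ) equals its Euclidean dual. -/
open Finset

noncomputable section

variable {F : Type} [Field F]

/-- Hamming weight of a vector. -/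
def wt {n : ℕ} [DecidableEq F] (c : Fin n → F) : ℕ :=
  (Finset.univ.filter fun i => c i ≠ 0).card

/-- Minimum distance of a linear code. -/
def minDist {n : ℕ} [DecidableEq F] (C : Submodule F (Fin n → F)) : ℕ :=
  sInf {w | ∃ c ∈ C, c ≠ 0 ∧ wt c = w}

/-- Euclidean dual of a linear code. -/
def dualCode {n : ℕ} (C : Submodule F (Fin n → F)) : Submodule F (Fin n → F) where
  carrier := {b | ∀ a ∈ C, ∑ i, a i * b i = 0}
  add_mem' := by
    intro x y hx hy a ha
    simp only [Set.mem_setOf_eq] at hx hy ⊢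
    simp [Pi.add_apply, mul_add, Finset.sum_add_distrib, hx a ha, hy a ha]
  zero_mem' := by intro a _; simp
  smul_mem' := by
    intro c x hx a ha
    simp only [Set.mem_setOf_eq] at hx ⊢
    simp [Pi.smul_apply, smul_eq_mul, mul_left_comm, ← Finset.mul_sum, hx a ha]

/-- MDS code: minimum distance d satisfies d = n - k + 1 where k is the dimension. -/
def IsMDSCode {n : ℕ} [DecidableEq F] (C : Submodule F (Fin n → F)) : Prop :=
  minDist C + Module.finrank F C = n + 1

/-- AMDS code: minimum distance d satisfies d = n - k where k is the dimension. -/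
def IsAMDSCode {n : ℕ} [DecidableEq F] (C : Submodule F (Fin n → F)) : Prop :=
  minDist C + Module.finrank F C = n

/-- NMDS code: both the code and its dual are AMDS. -/
def IsNMDSCode {n : ℕ} [DecidableEq F] (C : Submodule F (Fin n → F)) : Prop :=
  IsAMDSCode C ∧ IsAMDSCode (dualCode C)

/-- Exponents used in the generator matrix: k, k-2, k-3, ..., 1, 0 (skipping k-1). -/
def genExp (k : ℕ) (i : Fin k) : ℕ :=
  if (i : ℕ) = 0 then k else k - ((i : ℕ) + 1)

/-- The generator matrix of the code `C(A,k,λ)`. -/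
def genMatrix {n k : ℕ} (a : Fin n → F) (lam : Fin n → F) : Matrix (Fin k) (Fin n) F :=
  Matrix.of fun i j => lam j * a j ^ genExp k i

/-- The code `C(A,k,λ)`. -/
def codeC (n k : ℕ) (a : Fin n → F) (lam : Fin n → F) : Submodule F (Fin n → F) :=
  Submodule.span F (Set.range (genMatrix (n := n) (k := k) a lam))


theorem genExp_le {k : ℕ} (i : Fin k) : genExp k i ≤ k := by
  unfold genExp; split_ifs <;> omega

theorem genExp_ne_pred {k : ℕ} (i : Fin k) : genExp k i + 1 ≠ k := by
  unfold genExp; split_ifs <;> omega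

theorem genExp_injective (k : ℕ) : Function.Injective (genExp k) := by
  intro i j h
  unfold genExp at h
  ext
  split_ifs at h <;> omega

theorem genExp_add_genExp_ne {k : ℕ} (i j : Fin k) :
    genExp k i + genExp k j ≠ 2 * k - 1 := by
  have hi := genExp_le i
  have hj := genExp_le j
  have hi' := genExp_ne_pred i
  have hj' := genExp_ne_pred j
  have := i.pos
  omega

/-- The rows of the generator matrix are linearly independent as soon as there are more than `k`
evaluation points. -/
theorem linearIndependent_genMatrix {n k : ℕ} (hkn : k < n) {a lam : Fin n → F}
    (ha : Function.Injective a) (hlam : ∀ i, lam i ≠ 0) :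
    LinearIndependent F (genMatrix (k := k) a lam).row := by
  rw [Fintype.linearIndependent_iff]
  intro g hg i
  set p : Polynomial F := ∑ i, Polynomial.monomial (genExp k i) (g i) with hp
  have hdeg : p.natDegree ≤ k :=
    Polynomial.natDegree_sum_le_of_forall_le _ _ fun i _ =>
      (Polynomial.natDegree_monomial_le _).trans (genExp_le i)
  have hroot (j : Fin n) : p.eval (a j) = 0 := by
    have h := congrFun hg j
    simp only [genMatrix, Finset.sum_apply, Pi.smul_apply, Matrix.row, Matrix.of_apply,
      smul_eq_mul, Pi.zero_apply] at h
    refine (mul_eq_zero.mp ?_).resolve_left (hlam j)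
    rw [← h, hp, Polynomial.eval_finsetSum, Finset.mul_sum]
    refine Finset.sum_congr rfl fun i _ => ?_
    rw [Polynomial.eval_monomial]
    ring
  have hp0 : p = 0 :=
    Polynomial.eq_zero_of_natDegree_lt_card_of_eval_eq_zero p ha hroot
      (by rw [Fintype.card_fin]; omega)
  have hc := congrArg (fun r => Polynomial.coeff r (genExp k i)) hp0
  simpa [hp, Polynomial.finsetSum_coeff, Polynomial.coeff_monomial,
    (genExp_injective k).eq_iff] using hc

theorem mem_dualCode_span_range_iff {ι : Type*} {n : ℕ} (v : ι → Fin n → F) (b : Fin n → F) :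
    b ∈ dualCode (Submodule.span F (Set.range v)) ↔ ∀ i, ∑ j, v i j * b j = 0 := by
  refine ⟨fun h i => h _ (Submodule.subset_span ⟨i, rfl⟩), fun h c hc => ?_⟩
  induction hc using Submodule.span_induction with
  | mem x hx => obtain ⟨i, rfl⟩ := hx; exact h i
  | zero => simp
  | add x y _ _ hx hy => simp [add_mul, Finset.sum_add_distrib, hx, hy]
  | smul r x _ hx => simp [mul_assoc, ← Finset.mul_sum, hx]

theorem dualCode_span_range_eq_ker {m n : ℕ} (M : Matrix (Fin m) (Fin n) F) :
    dualCode (Submodule.span F (Set.range M.row)) = LinearMap.ker M.mulVecLin := by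
  ext b
  rw [mem_dualCode_span_range_iff, LinearMap.mem_ker, Matrix.mulVecLin_apply, funext_iff]
  rfl

/-- if ∑ λ_i² a_i^j = 0 for all j ∈ {0,…,2k-2} ∪ {2k}, then `C(A,k,λ)`
(of length 2k) is self-dual. -/
theorem stmt6 (q k : ℕ) (hq : IsPrimePow q) [Fintype F] (hcard : Fintype.card F = q)
    (hk : 1 ≤ k)
    (a : Fin (2 * k) → F) (ha : Function.Injective a)
    (lam : Fin (2 * k) → F) (hlam : ∀ i, lam i ≠ 0)
    (hmom : ∀ j : ℕ, j ≤ 2 * k → j ≠ 2 * k - 1 → ∑ i, lam i ^ 2 * a i ^ j = 0) :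
    codeC (2 * k) k a lam = dualCode (codeC (2 * k) k a lam) := by
  have hli := linearIndependent_genMatrix (k := k) (by omega) ha hlam
  refine Submodule.eq_of_le_of_finrank_eq ?_ ?_
  · refine Submodule.span_le.mpr ?_
    rintro _ ⟨i, rfl⟩
    refine (mem_dualCode_span_range_iff _ _).mpr fun j => ?_
    have hle := add_le_add (genExp_le j) (genExp_le i)
    rw [← hmom (genExp k j + genExp k i) (by omega) (genExp_add_genExp_ne j i)]
    refine Finset.sum_congr rfl fun l _ => ?_
    simp only [genMatrix, Matrix.of_apply]
    ring
  · have hC : Module.finrank F (codeC (2 * k) k a lam) = k :=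
      (finrank_span_eq_card hli).trans (Fintype.card_fin k)
    have hrank : Module.finrank F (genMatrix (k := k) a lam).mulVecLin.range = k :=
      hli.rank_matrix.trans (Fintype.card_fin k)
    have hker := (genMatrix (k := k) a lam).mulVecLin.finrank_range_add_finrank_ker
    rw [Module.finrank_fin_fun, hrank] at hker
    have hdual : dualCode (codeC (2 * k) k a lam) = (genMatrix (k := k) a lam).mulVecLin.ker :=
      dualCode_span_range_eq_ker _
    rw [hC, hdual]
    omega

end
end

section
/- Let r be an odd prime power and q = r^2. Let s and t be integers with 1 ≤ s ≤ (r+1)/2 and 1 ≤ t ≤ (r-1)/2, and set n = s(r-1) + t(r+1). If either (1) r ≡ 1 (mod 4) and s is even, or (2) r ≡ 3 (mod 4) and s is odd, then there exists a q-ary NMDS self-dual code of length n. -/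
open Finset

noncomputable section

variable {F : Type} [Field F]

open Polynomial in
/-- Polynomials of degree at most `k` whose coefficient of `X ^ (k - 1)` vanishes. -/
def gapPoly (F : Type) [Field F] (k : ℕ) : Submodule F F[X] :=
  degreeLT F (k + 1) ⊓ LinearMap.ker (lcoeff F (k - 1))

open Polynomial in
/-- The evaluation map `f ↦ (lam i * f (v i))ᵢ`. -/
def twistedEval {n : ℕ} (v lam : Fin n → F) : F[X] →ₗ[F] (Fin n → F) :=
  LinearMap.pi fun i => lam i • leval (v i)

open Polynomial in
lemma twistedEval_apply {n : ℕ} (v lam : Fin n → F) (f : F[X]) (i : Fin n) :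
    twistedEval v lam f i = lam i * f.eval (v i) := by
  simp [twistedEval]

open Polynomial in
lemma finrank_gapPoly {k : ℕ} : Module.finrank F (gapPoly F k) = k := by
  have e := degreeLTEquiv F (k + 1)
  have : Module.Finite F (degreeLT F (k + 1)) := Module.Finite.equiv e.symm
  have hrank : Module.finrank F (degreeLT F (k + 1)) = k + 1 := by
    rw [e.finrank_eq, Module.finrank_fin_fun]
  have h : gapPoly F k = Submodule.map (degreeLT F (k + 1)).subtype
      (LinearMap.ker ((lcoeff F (k - 1)).domRestrict (degreeLT F (k + 1)))) := by
    rw [LinearMap.ker_domRestrict, Submodule.map_comap_subtype]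
    rfl
  have hsurj : Function.Surjective ((lcoeff F (k - 1)).domRestrict (degreeLT F (k + 1))) := by
    refine LinearMap.surjective fun h0 => one_ne_zero (α := F) ?_
    have hmem : (X ^ (k - 1) : F[X]) ∈ degreeLT F (k + 1) := by
      rw [mem_degreeLT, degree_X_pow]
      exact_mod_cast (by omega : k - 1 < k + 1)
    simpa using LinearMap.congr_fun h0 ⟨_, hmem⟩
  have := LinearMap.finrank_range_add_finrank_ker
    ((lcoeff F (k - 1)).domRestrict (degreeLT F (k + 1)))
  rw [LinearMap.range_eq_top.mpr hsurj, finrank_top, Module.finrank_self, hrank] at this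
  rw [h, Submodule.finrank_map_subtype_eq]
  omega

open Polynomial in
lemma card_le_wt_twistedEval {n k : ℕ} [DecidableEq F] {v lam : Fin n → F}
    (hv : Function.Injective v) (hlam : ∀ i, lam i ≠ 0) {f : F[X]} (hf : f ∈ degreeLT F (k + 1))
    (hf0 : f ≠ 0) : n ≤ wt (twistedEval v lam f) + k := by
  have hdeg : f.natDegree ≤ k := by
    rw [mem_degreeLT] at hf
    exact Nat.lt_succ_iff.mp ((natDegree_lt_iff_degree_lt hf0).mpr hf)
  have hsub : (univ.filter fun i => ¬ twistedEval v lam f i ≠ 0).image v ⊆ f.roots.toFinset := by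
    intro x hx
    simp only [mem_image, mem_filter, mem_univ, true_and, not_not, twistedEval_apply,
      mul_eq_zero, hlam, false_or] at hx
    obtain ⟨i, hi, rfl⟩ := hx
    simpa [hf0] using hi
  have h1 := card_le_card hsub
  rw [card_image_of_injective _ hv] at h1
  have h2 := f.roots.toFinset_card_le
  have h3 := f.card_roots'
  have h4 := card_filter_add_card_filter_not (s := (univ : Finset (Fin n)))
    (fun i => twistedEval v lam f i ≠ 0)
  rw [card_univ, Fintype.card_fin] at h4
  unfold wt
  omega

open Polynomial in
lemma twistedEval_injOn {n k : ℕ} {v lam : Fin n → F} (hv : Function.Injective v)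
    (hlam : ∀ i, lam i ≠ 0) (hk : k < n) {f : F[X]} (hf : f ∈ degreeLT F (k + 1))
    (h : twistedEval v lam f = 0) : f = 0 := by
  classical
  by_contra hf0
  have := card_le_wt_twistedEval hv hlam hf hf0
  rw [h] at this
  simp [wt] at this
  omega

lemma finrank_dualCode_add {n : ℕ} (C : Submodule F (Fin n → F)) :
    Module.finrank F (dualCode C) + Module.finrank F C = n := by
  have h : (dualCode C).map (dotProductEquiv F (Fin n)).toLinearMap = C.dualAnnihilator := by
    ext φ
    obtain ⟨b, rfl⟩ := (dotProductEquiv F (Fin n)).surjective φ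
    rw [Submodule.mem_dualAnnihilator]
    constructor
    · rintro ⟨b', hb', hbb⟩ a ha
      rw [← hbb]
      simpa [dotProduct, mul_comm] using hb' a ha
    · intro hb
      refine ⟨b, fun a ha => ?_, rfl⟩
      simpa [dotProduct, mul_comm] using hb a ha
  have h1 := Subspace.finrank_add_finrank_dualAnnihilator_eq C
  rw [← h, LinearEquiv.finrank_map_eq, Module.finrank_fin_fun] at h1
  omega

open Polynomial in
/-- If the nodes in `A` sum to zero, Lagrange's functional extracts the coefficient of `X ^ (n - 1)`
from polynomials of degree at most `n = #A`. -/
lemma sum_eval_div_eq_coeff [DecidableEq F] {A : Finset F} (hA : 0 < #A) (hsum : ∑ a ∈ A, a = 0)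
    {f : F[X]} (hf : f.natDegree ≤ #A) :
    ∑ a ∈ A, f.eval a / ∏ b ∈ A.erase a, (a - b) = f.coeff (#A - 1) := by
  set P : F[X] := ∏ a ∈ A, (X - C a) with hP
  have hPm : P.Monic := monic_prod_of_monic _ _ fun a _ => monic_X_sub_C a
  have hPd : P.natDegree = #A := by simp [hP]
  have hPc : P.coeff (#A - 1) = 0 := by
    rw [hP, prod_X_sub_C_coeff_card_pred A (fun a => a) hA, hsum, neg_zero]
  set g : F[X] := f - C (f.coeff #A) * P with hg
  have hgd : g.degree < #A := by
    rw [degree_lt_iff_coeff_zero]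
    intro m hm
    rcases hm.eq_or_lt with rfl | hm
    · have : P.coeff #A = 1 := by rw [← hPd]; exact hPm
      simp [hg, this]
    · rw [hg, coeff_sub, coeff_C_mul, coeff_eq_zero_of_natDegree_lt (hf.trans_lt hm),
        coeff_eq_zero_of_natDegree_lt (hPd.trans_lt hm), mul_zero, sub_zero]
  have hgf : g.coeff (#A - 1) = f.coeff (#A - 1) := by simp [hg, hPc]
  rw [← hgf, Lagrange.coeff_eq_sum (v := fun a => a) (fun _ _ _ _ h => h) hgd]
  refine sum_congr rfl fun a ha => ?_
  have : P.eval a = 0 := by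
    rw [hP, eval_prod]
    exact prod_eq_zero ha (by simp)
  simp [hg, this]

open Polynomial in
lemma coeff_mul_gapPoly {k : ℕ} (hk : 1 ≤ k) {f g : F[X]} (hf : f ∈ gapPoly F k)
    (hg : g ∈ gapPoly F k) :
    (f * g).natDegree ≤ 2 * k ∧ (f * g).coeff (2 * k - 1) = 0 := by
  obtain ⟨hf1, hf2⟩ := hf
  obtain ⟨hg1, hg2⟩ := hg
  have hf1 := mem_degreeLT.mp hf1
  have hg1 := mem_degreeLT.mp hg1
  rw [degree_lt_iff_coeff_zero] at hf1 hg1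
  have hf2 : f.coeff (k - 1) = 0 := hf2
  have hg2 : g.coeff (k - 1) = 0 := hg2
  constructor
  · have := natDegree_mul_le (p := f) (q := g)
    have h1 : f.natDegree ≤ k := natDegree_le_iff_coeff_eq_zero.mpr fun m hm => hf1 m hm
    have h2 : g.natDegree ≤ k := natDegree_le_iff_coeff_eq_zero.mpr fun m hm => hg1 m hm
    omega
  · rw [coeff_mul]
    refine sum_eq_zero fun ij hij => ?_
    rw [HasAntidiagonal.mem_antidiagonal] at hij
    rcases lt_trichotomy ij.1 k with h | h | h
    · rcases (show ij.1 = k - 1 ∨ k + 1 ≤ ij.2 by omega) with h' | h'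
      · rw [h', hf2, zero_mul]
      · rw [hg1 _ h', mul_zero]
    · rw [show ij.2 = k - 1 by omega, hg2, mul_zero]
    · rw [hf1 _ h, zero_mul]

open Polynomial in
/-- A set `A` of `2k` nodes with zero sum, on which the products `∏ (a - b)` all lie in one square
class, and which has a zero-sum `k`-subset, yields an NMDS self-dual code. -/
theorem exists_nmds_selfDual [DecidableEq F] {n k : ℕ} {A : Finset F} (hk : 1 ≤ k)
    (hn : n = 2 * k) (hA : #A = n) (hsum : ∑ a ∈ A, a = 0) {c : F} (hc : c ≠ 0)
    (hsq : ∀ a ∈ A, IsSquare (c * ∏ b ∈ A.erase a, (a - b)))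
    {S : Finset F} (hSA : S ⊆ A) (hS : #S = k) (hS0 : ∑ a ∈ S, a = 0) :
    ∃ C : Submodule F (Fin n → F), IsNMDSCode C ∧ C = dualCode C := by
  choose! μ hμ using hsq
  let e := A.equivFinOfCardEq hA
  let v : Fin n → F := fun i => e.symm i
  let lam : Fin n → F := fun i => (μ (v i))⁻¹
  have hvA : ∀ i, v i ∈ A := fun i => (e.symm i).2
  have hv : Function.Injective v := Subtype.val_injective.comp e.symm.injective
  have hlam : ∀ i, lam i ≠ 0 := by
    intro i h0
    have h1 : μ (v i) = 0 := inv_eq_zero.mp h0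
    have h2 := hμ _ (hvA i)
    rw [h1, mul_zero, mul_eq_zero, or_iff_right hc, prod_eq_zero_iff] at h2
    obtain ⟨b, hb, hb'⟩ := h2
    exact (mem_erase.mp hb).1 (sub_eq_zero.mp hb').symm
  let D := (gapPoly F k).map (twistedEval v lam)
  have hrank : Module.finrank F D = k := by
    have hinj : Function.Injective ((twistedEval v lam).domRestrict (gapPoly F k)) := by
      rw [injective_iff_map_eq_zero]
      intro f hf
      exact Subtype.ext (twistedEval_injOn hv hlam (by omega) f.2.1 hf)
    have h := LinearMap.finrank_range_of_inj hinj
    rwa [LinearMap.range_domRestrict, finrank_gapPoly] at h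
  have hself : D = dualCode D := by
    refine Submodule.eq_of_le_of_finrank_eq ?_ ?_
    · rintro _ ⟨g, hg, rfl⟩ _ ⟨f, hf, rfl⟩
      obtain ⟨h1, h2⟩ := coeff_mul_gapPoly hk hf hg
      have h3 := sum_eval_div_eq_coeff (A := A) (by omega) hsum (f := f * g) (by omega)
      rw [hA, hn, h2, ← sum_coe_sort, ← e.symm.sum_comp] at h3
      have h4 := congrArg (c⁻¹ * ·) h3
      simp only [mul_sum, mul_zero] at h4
      rw [← h4]
      refine sum_congr rfl fun i _ => ?_
      have h5 := hμ _ (hvA i)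
      have h6 : lam i * lam i = c⁻¹ / ∏ b ∈ A.erase (v i), (v i - b) := by
        rw [div_eq_mul_inv, ← mul_inv c, h5, mul_inv]
      rw [twistedEval_apply, twistedEval_apply, mul_mul_mul_comm, h6, eval_mul]
      change _ = c⁻¹ * (eval (v i) f * eval (v i) g / ∏ b ∈ A.erase (v i), (v i - b))
      ring
    · have := finrank_dualCode_add D
      omega
  have hmem : k ∈ {w | ∃ c ∈ D, c ≠ 0 ∧ wt c = w} := by
    let f : F[X] := ∏ a ∈ S, (X - C a)
    have hfd : f.natDegree = k := by simp [f, hS]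
    have hf : f ∈ gapPoly F k := by
      refine ⟨mem_degreeLT.mpr ?_, ?_⟩
      · rw [degree_eq_natDegree (monic_prod_of_monic _ _ fun a _ => monic_X_sub_C a).ne_zero, hfd]
        exact_mod_cast k.lt_succ_self
      · change f.coeff (k - 1) = 0
        rw [← hS, prod_X_sub_C_coeff_card_pred S (fun a => a) (by omega), hS0, neg_zero]
    have hwt : wt (twistedEval v lam f) = k := by
      have h1 : (univ.filter fun i => twistedEval v lam f i ≠ 0).image v = A \ S := by
        ext x
        simp only [mem_image, mem_filter, mem_univ, true_and, mem_sdiff, twistedEval_apply, f,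
          eval_prod, eval_sub, eval_X, eval_C, ne_eq, mul_eq_zero, hlam, false_or,
          prod_eq_zero_iff, sub_eq_zero, not_exists, not_and]
        constructor
        · rintro ⟨i, hi, rfl⟩
          exact ⟨hvA i, fun h => hi _ h rfl⟩
        · rintro ⟨hx, hxS⟩
          refine ⟨e ⟨x, hx⟩, ?_, by simp [v]⟩
          rintro b hb hb'
          apply hxS
          have : v (e ⟨x, hx⟩) = x := by simp [v]
          rwa [← this, hb']
      rw [wt, ← card_image_of_injective _ hv, h1, card_sdiff_of_subset hSA]
      omega
    refine ⟨_, ⟨f, hf, rfl⟩, fun h0 => ?_, hwt⟩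
    rw [h0] at hwt
    simp [wt] at hwt
    omega
  have hdist : minDist D = k := by
    refine le_antisymm (Nat.sInf_le ?_) (le_csInf ?_ ?_)
    · exact hmem
    · exact ⟨k, hmem⟩
    · rintro _ ⟨_, ⟨f, hf, rfl⟩, hf0, rfl⟩
      have := card_le_wt_twistedEval hv hlam hf.1 fun h => hf0 (by rw [h, map_zero])
      omega
  have hamds : IsAMDSCode D := by
    unfold IsAMDSCode
    omega
  exact ⟨D, ⟨hamds, hself ▸ hamds⟩, hself⟩

lemma exists_zero_sum_even [DecidableEq F] {B : Finset F} (hneg : ∀ b ∈ B, -b ∈ B)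
    (h0 : ∀ b ∈ B, -b ≠ b) (j : ℕ) (hj : 2 * j ≤ #B) :
    ∃ S ⊆ B, #S = 2 * j ∧ ∑ a ∈ S, a = 0 ∧ ∀ a ∈ S, -a ∈ S := by
  induction j with
  | zero => exact ⟨∅, by simp⟩
  | succ j ih =>
    obtain ⟨S, hSB, hS, hsum, hSneg⟩ := ih (by omega)
    obtain ⟨x, hxB, hxS⟩ := exists_mem_notMem_of_card_lt_card (s := S) (t := B) (by omega)
    have hx : -x ∉ insert x S := by
      rw [mem_insert, not_or]
      exact ⟨h0 x hxB, fun h => hxS (by simpa using hSneg _ h)⟩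
    refine ⟨insert (-x) (insert x S), ?_, ?_, ?_, ?_⟩
    · exact insert_subset (hneg x hxB) (insert_subset hxB hSB)
    · rw [card_insert_of_notMem hx, card_insert_of_notMem hxS, hS]
      ring
    · rw [sum_insert hx, sum_insert hxS, hsum]
      ring
    · intro a ha
      simp only [mem_insert] at ha ⊢
      rcases ha with rfl | rfl | ha
      · simp
      · simp
      · exact Or.inr (Or.inr (hSneg a ha))

lemma exists_zero_sum_half [DecidableEq F] {A T : Finset F} {k : ℕ} (hneg : ∀ b ∈ A, -b ∈ A)
    (h0 : ∀ b ∈ A, -b ≠ b) (hA : #A = 2 * k) (hk : 3 ≤ k) (hTA : T ⊆ A) (hT : #T = 3)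
    (hT0 : ∑ a ∈ T, a = 0) :
    ∃ S ⊆ A, #S = k ∧ ∑ a ∈ S, a = 0 := by
  rcases Nat.even_or_odd' k with ⟨j, rfl | rfl⟩
  · obtain ⟨S, h1, h2, h3, -⟩ := exists_zero_sum_even hneg h0 j (by omega)
    exact ⟨S, h1, h2, h3⟩
  · let T' := T ∪ T.image (-·)
    have hT' : #T' ≤ 6 := by
      have h1 := card_union_le T (T.image (-·))
      have h2 : #(T.image (-·)) ≤ #T := card_image_le
      change #(T ∪ T.image (-·)) ≤ 6
      omega
    have hB := le_card_sdiff T' A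
    obtain ⟨S, h1, h2, h3, -⟩ := exists_zero_sum_even (B := A \ T') (fun b hb => by
        simp only [T', mem_sdiff, mem_union, mem_image, not_or] at hb ⊢
        refine ⟨hneg b hb.1, fun h => hb.2.2 ⟨_, h, neg_neg b⟩, ?_⟩
        rintro ⟨c, hc, hcb⟩
        exact hb.2.1 (neg_injective hcb ▸ hc))
      (fun b hb => h0 b (mem_sdiff.mp hb).1) (j - 1) (by omega)
    have hdisj : Disjoint S T := by
      rw [disjoint_left]
      intro a ha haT
      exact (mem_sdiff.mp (h1 ha)).2 (mem_union_left _ haT)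
    refine ⟨S ∪ T, union_subset (h1.trans sdiff_subset) hTA, ?_, ?_⟩
    · rw [card_union_of_disjoint hdisj]
      omega
    · rw [sum_union hdisj, h3, hT0, add_zero]

lemma sum_eq_zero_of_neg_mem [DecidableEq F] (h2 : (2 : F) ≠ 0) {A : Finset F}
    (hneg : ∀ b ∈ A, -b ∈ A) : ∑ a ∈ A, a = 0 := by
  have h : ∑ a ∈ A, a = ∑ a ∈ A, -a :=
    sum_nbij' (fun a => -a) (fun a => -a) hneg hneg (by simp) (by simp) (by simp)
  rw [sum_neg_distrib] at h
  have h' : 2 * ∑ a ∈ A, a = 0 := by linear_combination h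
  exact (mul_eq_zero.mp h').resolve_left h2

lemma exists_zero_sum_triple [DecidableEq F] {A : Finset F} {a u : F} (ha0 : a ≠ 0) (ha : a ∈ A)
    (hau : a * u ∈ A) (hau' : a * (-1 - u) ∈ A) (hu1 : u ≠ 1) (hu2 : u ≠ -2)
    (hu3 : 2 * u ≠ -1) : ∃ T ⊆ A, #T = 3 ∧ ∑ x ∈ T, x = 0 := by
  have e1 : a ≠ a * u := fun h => hu1 (mul_left_cancel₀ ha0 (by linear_combination -h))
  have e2 : a ≠ a * (-1 - u) := fun h => hu2 (mul_left_cancel₀ ha0 (by linear_combination h))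
  have e3 : a * u ≠ a * (-1 - u) := fun h => hu3 (mul_left_cancel₀ ha0 (by linear_combination h))
  refine ⟨{a, a * u, a * (-1 - u)}, ?_, ?_, ?_⟩
  · simp [insert_subset_iff, ha, hau, hau']
  · exact card_eq_three.mpr ⟨_, _, _, e1, e2, e3, rfl⟩
  · rw [sum_insert (by simp [e1, e2]), sum_insert (by simpa using e3), sum_singleton]
    ring

/-- The solutions of `x ^ d = c`. -/
def powFiber [Fintype F] [DecidableEq F] (d : ℕ) (c : F) : Finset F :=
  univ.filter fun x => x ^ d = c

lemma mem_powFiber [Fintype F] [DecidableEq F] {d : ℕ} {c x : F} :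
    x ∈ powFiber d c ↔ x ^ d = c := by
  simp [powFiber]

open Polynomial in
lemma prod_powFiber [Fintype F] [DecidableEq F] {d e : ℕ} (hde : d * e + 1 = Fintype.card F)
    {c : F} (hc : c ^ e = 1) : ∏ x ∈ powFiber d c, (X - C x) = X ^ d - C c := by
  have hcard : 1 < Fintype.card F := Fintype.one_lt_card
  have hd : d ≠ 0 := by
    rintro rfl
    omega
  have hq : (X ^ Fintype.card F - X : F[X]) ≠ 0 := FiniteField.X_pow_card_sub_X_ne_zero F hcard
  have hdvd : (X ^ d - C c : F[X]) ∣ X ^ Fintype.card F - X := by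
    have h : (X ^ d - C c : F[X]) ∣ (X ^ d) ^ e - (C c) ^ e := sub_dvd_pow_sub_pow _ _ _
    rw [← C_pow, hc, C_1, ← pow_mul] at h
    rw [← hde, show (X ^ (d * e + 1) - X : F[X]) = (X ^ (d * e) - 1) * X by ring]
    exact h.mul_right _
  have hs : (X ^ d - C c : F[X]).Splits := by
    have : (X ^ Fintype.card F - X : F[X]).Splits := by
      rw [splits_iff_card_roots, FiniteField.roots_X_pow_card_sub_X,
        FiniteField.X_pow_card_sub_X_natDegree_eq F hcard]
      rfl
    exact this.of_dvd hq hdvd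
  have hnd : (X ^ d - C c : F[X]).roots.Nodup := by
    refine Multiset.nodup_of_le (roots.le_of_dvd hq hdvd) ?_
    rw [FiniteField.roots_X_pow_card_sub_X]
    exact univ.nodup
  have hroots : (X ^ d - C c : F[X]).roots = (powFiber d c).val := by
    rw [Multiset.Nodup.ext hnd (powFiber d c).nodup]
    intro x
    rw [mem_roots (X_pow_sub_C_ne_zero (Nat.pos_of_ne_zero hd) c), mem_val, mem_powFiber]
    simp [sub_eq_zero]
  have h := hs.eq_prod_roots_of_monic (monic_X_pow_sub_C c hd)
  rw [h, hroots]
  rfl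

lemma card_powFiber [Fintype F] [DecidableEq F] {d e : ℕ} (hde : d * e + 1 = Fintype.card F)
    {c : F} (hc : c ^ e = 1) : #(powFiber d c) = d := by
  have h := congrArg Polynomial.natDegree (prod_powFiber hde hc)
  simpa using h

/-- The union of the fibres of `x ↦ x ^ d` over `Y`. -/
def powPreimage [Fintype F] [DecidableEq F] (d : ℕ) (Y : Finset F) : Finset F :=
  Y.biUnion (powFiber d)

lemma mem_powPreimage [Fintype F] [DecidableEq F] {d : ℕ} {Y : Finset F} {x : F} :
    x ∈ powPreimage d Y ↔ x ^ d ∈ Y := by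
  simp [powPreimage, mem_powFiber]

lemma pairwiseDisjoint_powFiber [Fintype F] [DecidableEq F] (d : ℕ) (Y : Set F) :
    Y.PairwiseDisjoint (powFiber d) := by
  intro y _ y' _ hne
  rw [Function.onFun, disjoint_left]
  intro x hx hx'
  exact hne ((mem_powFiber.mp hx).symm.trans (mem_powFiber.mp hx'))

lemma card_powPreimage [Fintype F] [DecidableEq F] {d e : ℕ} (hde : d * e + 1 = Fintype.card F)
    {Y : Finset F} (hY : ∀ y ∈ Y, y ^ e = 1) : #(powPreimage d Y) = #Y * d := by
  rw [powPreimage, card_biUnion (pairwiseDisjoint_powFiber d (Y : Set F)),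
    sum_congr rfl fun y hy => card_powFiber hde (hY y hy), sum_const, smul_eq_mul]

open Polynomial in
lemma prod_powPreimage [Fintype F] [DecidableEq F] {d e : ℕ} (hde : d * e + 1 = Fintype.card F)
    {Y : Finset F} (hY : ∀ y ∈ Y, y ^ e = 1) :
    ∏ x ∈ powPreimage d Y, (X - C x) = ∏ y ∈ Y, (X ^ d - C y) := by
  rw [powPreimage, prod_biUnion (pairwiseDisjoint_powFiber d (Y : Set F))]
  exact prod_congr rfl fun y hy => prod_powFiber hde (hY y hy)

open Polynomial in
lemma prod_erase_sub [Fintype F] [DecidableEq F] {d e d' e' : ℕ}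
    (hde : d * e + 1 = Fintype.card F) (hde' : d' * e' + 1 = Fintype.card F) {Y Z : Finset F}
    (hY : ∀ y ∈ Y, y ^ e = 1) (hZ : ∀ z ∈ Z, z ^ e' = 1)
    (hdisj : Disjoint (powPreimage d Y) (powPreimage d' Z)) {a : F} (ha : a ∈ powPreimage d Y) :
    ∏ b ∈ (powPreimage d Y ∪ powPreimage d' Z).erase a, (a - b) =
      d * a ^ (d - 1) * (∏ y ∈ Y.erase (a ^ d), (a ^ d - y)) * ∏ z ∈ Z, (a ^ d' - z) := by
  have haY := mem_powPreimage.mp ha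
  have h1 := Lagrange.eval_nodal_derivative_eval_node_eq (v := fun x : F => x)
    (s := powPreimage d Y ∪ powPreimage d' Z) (i := a) (mem_union_left _ ha)
  rw [Lagrange.eval_nodal, Lagrange.nodal_eq, prod_union hdisj, prod_powPreimage hde hY,
    prod_powPreimage hde' hZ, ← mul_prod_erase Y _ haY] at h1
  rw [← h1]
  simp [derivative_mul, derivative_X_pow, eval_prod, mul_assoc, -map_pow]

section SquareClass

variable {m : ℕ}

lemma sub_pow_mul_of_norm_one (hsub : ∀ x y : F, (x - y) ^ (2 * m + 1) = x ^ (2 * m + 1) -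
    y ^ (2 * m + 1)) {x y : F} (hx : x ^ (2 * m + 2) = 1) (hy : y ^ (2 * m + 2) = 1)
    (hne : x ≠ y) :
    (x - y) ^ (2 * m * (m + 1)) * (x ^ (m + 1) * y ^ (m + 1)) = (-1) ^ (m + 1) := by
  have h : (x - y) ^ (2 * m) * (x * y) = -1 := by
    apply mul_left_cancel₀ (sub_ne_zero.mpr hne)
    linear_combination x * y * hsub x y + y * hx - x * hy
  rw [pow_mul, ← mul_pow, ← mul_pow, h]

lemma sub_pow_of_mem_subfield (hsub : ∀ x y : F, (x - y) ^ (2 * m + 1) = x ^ (2 * m + 1) -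
    y ^ (2 * m + 1)) {x y : F} (hx : x ^ (2 * m) = 1) (hy : y ^ (2 * m) = 1)
    (hne : x ≠ y) : (x - y) ^ (2 * m * (m + 1)) = 1 := by
  have h : (x - y) ^ (2 * m) = 1 := by
    apply mul_left_cancel₀ (sub_ne_zero.mpr hne)
    linear_combination hsub x y + x * hx - y * hy
  rw [pow_mul, h, one_pow]

variable [Fintype F] [DecidableEq F] {Y Z : Finset F}

lemma disjoint_powPreimage (h2 : (2 : F) ≠ 0) (hY : ∀ y ∈ Y, y ^ (m + 1) = 1)
    (hZ : ∀ z ∈ Z, z ^ m = -1) :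
    Disjoint (powPreimage (2 * m) Y) (powPreimage (2 * m + 2) Z) := by
  rw [disjoint_left]
  intro x hx hx'
  have h1 := hY _ (mem_powPreimage.mp hx)
  have h3 := hZ _ (mem_powPreimage.mp hx')
  apply h2
  rw [← pow_mul] at h1 h3
  rw [show (2 * m + 2) * m = 2 * m * (m + 1) by ring, h1] at h3
  linear_combination h3

lemma pow_prod_erase_left (hcard : Fintype.card F = (2 * m + 1) ^ 2)
    (hchar : ((2 * m + 1 : ℕ) : F) = 0) (h2 : (2 : F) ≠ 0)
    (hsub : ∀ x y : F, (x - y) ^ (2 * m + 1) = x ^ (2 * m + 1) - y ^ (2 * m + 1))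
    (hY : ∀ y ∈ Y, y ^ (m + 1) = 1) (hZ : ∀ z ∈ Z, z ^ m = -1) {a : F}
    (ha : a ∈ powPreimage (2 * m) Y) :
    (∏ b ∈ (powPreimage (2 * m) Y ∪ powPreimage (2 * m + 2) Z).erase a, (a - b)) ^
      (2 * m * (m + 1)) = ((-1) ^ (m + 1)) ^ (#Y - 1) := by
  have hY' : ∀ y ∈ Y, y ^ (2 * m + 2) = 1 := fun y hy => by
    rw [show 2 * m + 2 = (m + 1) * 2 by ring, pow_mul, hY y hy, one_pow]
  have hZ' : ∀ z ∈ Z, z ^ (2 * m) = 1 := fun z hz => by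
    rw [mul_comm, pow_mul, hZ z hz, neg_one_sq]
  have haY := mem_powPreimage.mp ha
  have ha1 : a ^ (2 * m * (m + 1)) = 1 := by rw [pow_mul, hY _ haY]
  rw [prod_erase_sub (by rw [hcard]; ring) (by rw [hcard]; ring) hY' hZ'
    (disjoint_powPreimage h2 hY hZ) ha, mul_pow, mul_pow, mul_pow, ← prod_pow, ← prod_pow,
    ← pow_mul, mul_comm (2 * m - 1), pow_mul a, ha1, one_pow, ← card_erase_of_mem haY]
  have h3 : ((2 * m : ℕ) : F) = -1 := by
    push_cast at hchar ⊢
    linear_combination hchar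
  rw [h3, mul_assoc 2 m, pow_mul (-1 : F) 2, neg_one_sq, one_pow, ← mul_assoc 2 m, one_mul, one_mul]
  rw [prod_congr rfl (g := fun _ => (-1 : F) ^ (m + 1)), prod_const, prod_eq_one, mul_one]
  · intro z hz
    refine sub_pow_of_mem_subfield hsub ?_ (hZ' z hz) ?_
    · rw [← pow_mul, show (2 * m + 2) * (2 * m) = 2 * m * (m + 1) * 2 by ring, pow_mul, ha1,
        one_pow]
    · rintro rfl
      have h4 := hZ _ hz
      rw [← pow_mul, show (2 * m + 2) * m = 2 * m * (m + 1) by ring, ha1] at h4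
      exact h2 (by linear_combination h4)
  · intro y hy
    obtain ⟨hne, hy⟩ := mem_erase.mp hy
    have := sub_pow_mul_of_norm_one hsub (hY' _ haY) (hY' _ hy) hne.symm
    rwa [hY _ haY, hY _ hy, mul_one, mul_one] at this

lemma pow_prod_erase_right (hcard : Fintype.card F = (2 * m + 1) ^ 2)
    (hchar : ((2 * m + 1 : ℕ) : F) = 0) (h2 : (2 : F) ≠ 0)
    (hsub : ∀ x y : F, (x - y) ^ (2 * m + 1) = x ^ (2 * m + 1) - y ^ (2 * m + 1))
    (hY : ∀ y ∈ Y, y ^ (m + 1) = 1) (hZ : ∀ z ∈ Z, z ^ m = -1) {a : F}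
    (ha : a ∈ powPreimage (2 * m + 2) Z) :
    (∏ b ∈ (powPreimage (2 * m) Y ∪ powPreimage (2 * m + 2) Z).erase a, (a - b)) ^
      (2 * m * (m + 1)) = -((-1) ^ m) ^ #Y := by
  have hY' : ∀ y ∈ Y, y ^ (2 * m + 2) = 1 := fun y hy => by
    rw [show 2 * m + 2 = (m + 1) * 2 by ring, pow_mul, hY y hy, one_pow]
  have hZ' : ∀ z ∈ Z, z ^ (2 * m) = 1 := fun z hz => by
    rw [mul_comm, pow_mul, hZ z hz, neg_one_sq]
  have haZ := mem_powPreimage.mp ha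
  have ha1 : a ^ (2 * m * (m + 1)) = -1 := by
    rw [show 2 * m * (m + 1) = (2 * m + 2) * m by ring, pow_mul, hZ _ haZ]
  rw [union_comm, prod_erase_sub (by rw [hcard]; ring) (by rw [hcard]; ring) hZ' hY'
    (disjoint_powPreimage h2 hY hZ).symm ha, mul_pow, mul_pow, mul_pow, ← prod_pow, ← prod_pow,
    ← pow_mul, mul_comm (2 * m + 2 - 1), pow_mul a, ha1]
  have h3 : ((2 * m + 2 : ℕ) : F) = 1 := by
    push_cast at hchar ⊢
    linear_combination hchar
  rw [h3, one_pow, one_mul, show 2 * m + 2 - 1 = 2 * m + 1 by omega, pow_succ, pow_mul, neg_one_sq,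
    one_pow, one_mul]
  rw [prod_congr (s₁ := Y) rfl (g := fun _ => (-1 : F) ^ m), prod_const, prod_eq_one, mul_one,
    neg_one_mul]
  · intro z hz
    obtain ⟨hne, hz⟩ := mem_erase.mp hz
    exact sub_pow_of_mem_subfield hsub (hZ' _ haZ) (hZ' _ hz) hne.symm
  · intro y hy
    have h4 : (a ^ (2 * m)) ^ (m + 1) = -1 := by rw [← pow_mul, ha1]
    have := sub_pow_mul_of_norm_one (x := a ^ (2 * m)) hsub ?_ (hY' _ hy) ?_
    · rw [h4, hY _ hy] at this
      linear_combination -this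
    · rw [show 2 * m + 2 = (m + 1) * 2 by ring, pow_mul, h4, neg_one_sq]
    · rintro rfl
      rw [hY _ hy] at h4
      exact h2 (by linear_combination h4)

end SquareClass

lemma exists_pow_three_eq_one [Fintype F] (hdvd : 3 ∣ Fintype.card F - 1) :
    ∃ u : F, u ^ 3 = 1 ∧ u ^ 2 + u + 1 = 0 := by
  classical
  obtain ⟨e, he⟩ := hdvd
  have hc := Fintype.one_lt_card (α := F)
  have h := card_powFiber (F := F) (d := 3) (e := e) (c := 1) (by omega) (one_pow e)
  obtain ⟨u, hu, hu1⟩ := exists_mem_ne (s := powFiber 3 (1 : F)) (by omega) 1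
  rw [mem_powFiber] at hu
  refine ⟨u, hu, mul_left_cancel₀ (sub_ne_zero.mpr hu1) ?_⟩
  linear_combination hu

lemma exists_triple_powPreimage [Fintype F] [DecidableEq F] {m : ℕ} (hm : 1 ≤ m)
    (hcard : Fintype.card F = (2 * m + 1) ^ 2) (hchar : ((2 * m + 1 : ℕ) : F) = 0)
    (hthree : (3 : F) = 0 → 3 ∣ 2 * m + 1)
    (hthree' : 3 ∣ 2 * m + 1 → (3 : F) = 0)
    (hsub : ∀ x y : F, (x - y) ^ (2 * m + 1) = x ^ (2 * m + 1) - y ^ (2 * m + 1))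
    {Y Z : Finset F} (hY : ∀ y ∈ Y, y ^ (m + 1) = 1) (hZ : ∀ z ∈ Z, z ^ m = -1)
    (hZm : m = 1 → Z = {-1}) (hY0 : (powPreimage (2 * m) Y).Nonempty)
    (hZ0 : (powPreimage (2 * m + 2) Z).Nonempty) :
    ∃ T ⊆ powPreimage (2 * m) Y ∪ powPreimage (2 * m + 2) Z, #T = 3 ∧ ∑ x ∈ T, x = 0 := by
  obtain ⟨a, ha⟩ := hY0
  obtain ⟨b, hb⟩ := hZ0
  have haY := mem_powPreimage.mp ha
  have hbZ := mem_powPreimage.mp hb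
  have ha0 : a ≠ 0 := by
    rintro rfl
    have := hY _ haY
    simp [show m ≠ 0 by omega] at this
  have hb0 : b ≠ 0 := by
    rintro rfl
    have := hZ _ hbZ
    simp [show m ≠ 0 by omega] at this
  by_cases h3 : (3 : F) = 0
  · have hne : ∀ d : F, d ≠ 0 → 1 + d ≠ 1 ∧ 1 + d ≠ -2 ∧ 2 * (1 + d) ≠ -1 := by
      refine fun d hd => ⟨fun h => hd ?_, fun h => hd ?_, fun h => hd ?_⟩
      · linear_combination h
      · linear_combination h - h3
      · linear_combination -h + (1 + d) * h3
    rcases hm.eq_or_lt with rfl | hm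
    · obtain ⟨i, hi⟩ : ∃ i : F, i ^ 2 = -1 := by
        have h := card_powFiber (F := F) (d := 2) (e := 4) (c := -1) (by omega) (by norm_num)
        obtain ⟨i, hi⟩ := card_pos.mp (by omega : 0 < #(powFiber 2 (-1 : F)))
        exact ⟨i, mem_powFiber.mp hi⟩
      have hi0 : i ≠ 0 := by
        rintro rfl
        norm_num at hi
      have ha4 : a ^ 4 = 1 := by
        have := hY _ haY
        rw [← pow_mul] at this
        exact this
      obtain ⟨e1, e2, e3⟩ := hne i hi0
      refine exists_zero_sum_triple (u := 1 + i) ha0 (mem_union_left _ ha) (mem_union_right _ ?_)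
        (mem_union_right _ ?_) e1 e2 e3
      · rw [mem_powPreimage, hZm rfl, mem_singleton]
        linear_combination (1 + i) ^ 4 * ha4 + (i ^ 2 + 4 * i + 5) * hi - h3
      · rw [mem_powPreimage, hZm rfl, mem_singleton]
        linear_combination (2 + i) ^ 4 * ha4 + (i ^ 2 + 8 * i + 23) * hi + (8 * i - 2) * h3
    · have h9 : 8 ≤ 2 * m := by
        have := hthree h3
        omega
      obtain ⟨d, hd, hd3⟩ : ∃ d : F, d ^ (2 * m) = 1 ∧ d ^ 3 ≠ d := by
        have hc := card_powFiber (F := F) (d := 2 * m) (e := 2 * m + 2) (c := 1)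
          (by rw [hcard]; ring) (one_pow _)
        obtain ⟨d, hd, hd'⟩ := exists_mem_notMem_of_card_lt_card (s := {0, 1, -1})
          (t := powFiber (2 * m) (1 : F)) (card_le_three.trans_lt (by omega))
        refine ⟨d, mem_powFiber.mp hd, fun h => hd' ?_⟩
        have h' : d * ((d - 1) * (d + 1)) = 0 := by linear_combination h
        simpa [sub_eq_zero, add_eq_zero_iff_eq_neg] using h'
      have hd0 : d ≠ 0 := by
        rintro rfl
        exact hd3 (by norm_num)
      obtain ⟨e1, e2, e3⟩ := hne d hd0
      have hmem : ∀ w : F, w ≠ 0 → w ^ (2 * m + 1) = w → a * w ∈ powPreimage (2 * m) Y := by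
        intro w hw0 hw
        have : w ^ (2 * m) = 1 := mul_right_cancel₀ hw0 (by rw [← pow_succ, hw, one_mul])
        rwa [mem_powPreimage, mul_pow, this, mul_one]
      have hneg : ∀ w : F, (-w) ^ (2 * m + 1) = - w ^ (2 * m + 1) := fun w =>
        Odd.neg_pow ⟨m, rfl⟩ w
      have hd' : d ^ (2 * m + 1) = d := by rw [pow_succ, hd, one_mul]
      have hd1 : (1 + d) ^ (2 * m + 1) = 1 + d := by
        have := hsub 1 (-d)
        rw [hneg, hd', one_pow] at this
        simpa using this
      have hd2 : (-1 - (1 + d)) ^ (2 * m + 1) = -1 - (1 + d) := by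
        rw [hsub, hneg, one_pow, hd1]
      refine exists_zero_sum_triple (u := 1 + d) ha0 (mem_union_left _ ha)
        (mem_union_left _ (hmem _ ?_ hd1)) (mem_union_left _ (hmem _ ?_ hd2)) e1 e2 e3
      · intro h
        apply hd3
        rw [show d = -1 by linear_combination h]
        norm_num
      · intro h
        apply hd3
        rw [show d = 1 by linear_combination -h - h3]
        norm_num
  · have hmod : ¬ 3 ∣ 2 * m + 1 := fun h => h3 (hthree' h)
    have hdvd : 3 ∣ 2 * m ∨ 3 ∣ 2 * m + 2 := by
      rcases (by omega : m % 3 = 0 ∨ m % 3 = 2) with h | h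
      · exact Or.inl (by omega)
      · exact Or.inr (by omega)
    obtain ⟨u, hu3, hu⟩ := exists_pow_three_eq_one (F := F) (by
      rw [hcard, show (2 * m + 1) ^ 2 - 1 = 2 * m * (2 * m + 2) by
        rw [show (2 * m + 1) ^ 2 = 2 * m * (2 * m + 2) + 1 by ring]; rfl]
      rcases hdvd with h | h
      · exact h.mul_right _
      · exact h.mul_left _)
    have hu' : -1 - u = u ^ 2 := by linear_combination -hu
    have e1 : u ≠ 1 := by
      rintro rfl
      exact h3 (by linear_combination hu)
    have e2 : u ≠ -2 := by
      rintro rfl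
      exact h3 (by linear_combination hu)
    have e3 : 2 * u ≠ -1 := fun h => h3 (by linear_combination 4 * hu - (2 * u + 1) * h)
    have hmem : ∀ (d : ℕ) (W : Finset F) (x : F), 3 ∣ d → x ∈ powPreimage d W →
        x * u ∈ powPreimage d W ∧ x * (-1 - u) ∈ powPreimage d W := by
      rintro _ W x ⟨d, rfl⟩ hx
      rw [mem_powPreimage] at hx
      rw [hu', mem_powPreimage, mem_powPreimage, mul_pow, mul_pow, pow_right_comm, pow_mul u, hu3,
        one_pow, one_pow, mul_one]
      exact ⟨hx, hx⟩
    rcases hdvd with h | h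
    · obtain ⟨h4, h5⟩ := hmem _ _ _ h ha
      exact exists_zero_sum_triple ha0 (mem_union_left _ ha) (mem_union_left _ h4)
        (mem_union_left _ h5) e1 e2 e3
    · obtain ⟨h4, h5⟩ := hmem _ _ _ h hb
      exact exists_zero_sum_triple hb0 (mem_union_right _ hb) (mem_union_right _ h4)
        (mem_union_right _ h5) e1 e2 e3

/-- for q = r² with r an odd prime power, 1 ≤ s ≤ (r+1)/2,
1 ≤ t ≤ (r-1)/2, n = s(r-1) + t(r+1), and (r ≡ 1 mod 4 with s even) or
(r ≡ 3 mod 4 with s odd), there is a q-ary NMDS self-dual code of length n. -/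
theorem stmt12 (r s t : ℕ) (hr : IsPrimePow r) (hodd : Odd r)
    [Fintype F] [DecidableEq F] (hcard : Fintype.card F = r ^ 2)
    (hs1 : 1 ≤ s) (hs2 : s ≤ (r + 1) / 2) (ht1 : 1 ≤ t) (ht2 : t ≤ (r - 1) / 2)
    (hcond : (r % 4 = 1 ∧ Even s) ∨ (r % 4 = 3 ∧ Odd s)) :
    ∃ C : Submodule F (Fin (s * (r - 1) + t * (r + 1)) → F),
      IsNMDSCode C ∧ C = dualCode C := by
  obtain ⟨m, rfl⟩ := hodd
  have hm : 1 ≤ m := by omega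
  obtain ⟨p, e, hp, he, hpe⟩ := hr
  have hp := hp.nat_prime
  have hr0 : ((2 * m + 1 : ℕ) : F) = 0 := by
    have := Nat.cast_card_eq_zero F
    rw [hcard, Nat.cast_pow] at this
    exact pow_eq_zero_iff two_ne_zero |>.mp this
  have hp0 : (p : F) = 0 := by
    rw [← hpe, Nat.cast_pow] at hr0
    exact pow_eq_zero_iff he.ne' |>.mp hr0
  have : Fact p.Prime := ⟨hp⟩
  have : CharP F p := (CharP.charP_iff_prime_eq_zero hp).mpr hp0
  have hsub : ∀ x y : F, (x - y) ^ (2 * m + 1) = x ^ (2 * m + 1) - y ^ (2 * m + 1) := by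
    intro x y
    rw [← hpe]
    exact sub_pow_char_pow x y e
  have h2 : (2 : F) ≠ 0 := by
    intro h
    push_cast at hr0
    exact one_ne_zero (α := F) (by linear_combination hr0 - m * h)
  have hthree : (3 : F) = 0 → 3 ∣ 2 * m + 1 := by
    intro h
    have h : ((3 : ℕ) : F) = 0 := by exact_mod_cast h
    rw [CharP.cast_eq_zero_iff F p, Nat.prime_dvd_prime_iff_eq hp Nat.prime_three] at h
    rw [← hpe, h]
    exact dvd_pow_self 3 he.ne'
  have hthree' : 3 ∣ 2 * m + 1 → (3 : F) = 0 := by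
    rintro h
    rw [← hpe] at h
    rw [← (Nat.prime_dvd_prime_iff_eq Nat.prime_three hp).mp (Nat.prime_three.dvd_of_dvd_pow h)]
      at hp0
    exact_mod_cast hp0
  obtain ⟨Y, hYsub, hYs⟩ := exists_subset_card_eq (s := powFiber (m + 1) (1 : F)) (n := s) (by
    rw [card_powFiber (e := 4 * m) (by rw [hcard]; ring) (one_pow _)]
    omega)
  have hZcard : #(powFiber m (-1 : F)) = m :=
    card_powFiber (e := 4 * (m + 1)) (by rw [hcard]; ring) (by rw [mul_comm, pow_mul']; norm_num)
  obtain ⟨Z, hZsub, hZt⟩ := exists_subset_card_eq (s := powFiber m (-1 : F)) (n := t) (by omega)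
  have hY : ∀ y ∈ Y, y ^ (m + 1) = 1 := fun y hy => mem_powFiber.mp (hYsub hy)
  have hZ : ∀ z ∈ Z, z ^ m = -1 := fun z hz => mem_powFiber.mp (hZsub hz)
  have hcY : #(powPreimage (2 * m) Y) = s * (2 * m) := by
    rw [← hYs]
    refine card_powPreimage (e := 2 * m + 2) (by rw [hcard]; ring) fun y hy => ?_
    rw [show 2 * m + 2 = (m + 1) * 2 by ring, pow_mul, hY y hy, one_pow]
  have hcZ : #(powPreimage (2 * m + 2) Z) = t * (2 * m + 2) := by
    rw [← hZt]
    refine card_powPreimage (e := 2 * m) (by rw [hcard]; ring) fun z hz => ?_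
    rw [mul_comm, pow_mul, hZ z hz, neg_one_sq]
  set A := powPreimage (2 * m) Y ∪ powPreimage (2 * m + 2) Z with hA
  have hAcard : #A = s * (2 * m + 1 - 1) + t * (2 * m + 1 + 1) := by
    rw [hA, card_union_of_disjoint (disjoint_powPreimage h2 hY hZ), hcY, hcZ]
    rfl
  have hn : s * (2 * m + 1 - 1) + t * (2 * m + 1 + 1) = 2 * (s * m + t * (m + 1)) := by
    rw [Nat.add_sub_cancel]
    ring
  have hk : 3 ≤ s * m + t * (m + 1) := by nlinarith
  have hneg : ∀ b ∈ A, -b ∈ A := by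
    intro b hb
    rw [hA, mem_union, mem_powPreimage, mem_powPreimage] at hb ⊢
    rwa [Even.neg_pow (by simp), Even.neg_pow (by simp [parity_simps])]
  have h0 : ∀ b ∈ A, b ≠ 0 := by
    rintro _ hb rfl
    rw [hA, mem_union, mem_powPreimage, mem_powPreimage, zero_pow (by omega),
      zero_pow (by omega)] at hb
    rcases hb with hb | hb
    · simpa using hY _ hb
    · have := hZ _ hb
      simp [show m ≠ 0 by omega] at this
  have h0' : ∀ b ∈ A, -b ≠ b := fun b hb h =>
    h0 b hb ((mul_eq_zero.mp (by linear_combination -h : 2 * b = 0)).resolve_left h2)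
  obtain ⟨T, hTA, hT, hT0⟩ := exists_triple_powPreimage hm hcard hr0 hthree hthree' hsub hY hZ
    (by
      rintro rfl
      obtain ⟨z, rfl⟩ := card_eq_one.mp (by omega : #Z = 1)
      have := hZ z (mem_singleton_self z)
      rw [← this, pow_one])
    (card_pos.mp (by rw [hcY]; positivity)) (card_pos.mp (by rw [hcZ]; positivity))
  obtain ⟨S, hSA, hS, hS0⟩ := exists_zero_sum_half hneg h0' (hAcard.trans hn) hk hTA hT hT0
  have hpar : Even (s + m) := by
    rcases hcond with ⟨h1, h2⟩ | ⟨h1, h2⟩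
    · exact h2.add (Nat.even_iff.mpr (by omega))
    · exact h2.add_odd (Nat.odd_iff.mpr (by omega))
  have hclass : ∀ a ∈ A, (∏ b ∈ A.erase a, (a - b)) ^ (2 * m * (m + 1)) =
      ((-1) ^ (m + 1)) ^ (s - 1) := by
    intro a ha
    rcases mem_union.mp ha with h | h
    · rw [pow_prod_erase_left hcard hr0 h2 hsub hY hZ h, hYs]
    · rw [pow_prod_erase_right hcard hr0 h2 hsub hY hZ h, hYs]
      obtain ⟨s, rfl⟩ : ∃ s', s = s' + 1 := ⟨s - 1, by omega⟩
      rw [Nat.add_sub_cancel, ← pow_mul, ← pow_mul, neg_eq_neg_one_mul, ← pow_succ']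
      apply neg_one_pow_congr
      simp only [parity_simps] at hpar ⊢
      tauto
  obtain ⟨a₀, ha₀⟩ : A.Nonempty := card_pos.mp (by omega)
  have hprod : ∀ a ∈ A, ∏ b ∈ A.erase a, (a - b) ≠ 0 := fun a _ =>
    prod_ne_zero_iff.mpr fun b hb => sub_ne_zero.mpr (mem_erase.mp hb).1.symm
  refine exists_nmds_selfDual (by omega) hn hAcard (sum_eq_zero_of_neg_mem h2 hneg)
    (hprod a₀ ha₀) (fun a ha => ?_) hSA hS hS0
  have hF2 : ringChar F ≠ 2 := by
    intro h
    have := ringChar.Nat.cast_ringChar (R := F)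
    rw [h] at this
    exact h2 (by exact_mod_cast this)
  rw [FiniteField.isSquare_iff hF2 (mul_ne_zero (hprod a₀ ha₀) (hprod a ha)), hcard,
    show (2 * m + 1) ^ 2 / 2 = 2 * m * (m + 1) by
      rw [show (2 * m + 1) ^ 2 = 2 * (2 * m * (m + 1)) + 1 by ring]; omega,
    mul_pow, hclass a₀ ha₀, hclass a ha, ← mul_pow, ← mul_pow]
  simp

end
end

section
/- Let p be an odd prime, r = p^m, and q = r^2. Let t and s be even integers with 1 ≤ t ≤ r and 0 ≤ s ≤ p^{m-t'} - 1, where t' = ⌈log_p(t)⌉. Set n = t·r + s·p^{t'}. Then there exists a q-ary NMDS self-dual code of length n. -/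
open Finset

noncomputable section

variable {F : Type} [Field F]

open Polynomial in
/-- The code of weighted evaluations of the polynomials in `gapPoly`. -/
def gapCode (F : Type) [Field F] {n : ℕ} (k : ℕ) (a lam : Fin n → F) :
    Submodule F (Fin n → F) :=
  (gapPoly F k).map (LinearMap.pi fun j => lam j • leval (a j))

open Polynomial in
theorem mem_gapPoly {k : ℕ} {f : F[X]} :
    f ∈ gapPoly F k ↔ f.natDegree ≤ k ∧ f.coeff (k - 1) = 0 := by
  rw [gapPoly, Submodule.mem_inf, LinearMap.mem_ker, lcoeff_apply, degreeLT_succ_eq_degreeLE,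
    mem_degreeLE, natDegree_le_iff_degree_le]

open Polynomial in
theorem mem_gapCode {n k : ℕ} {a lam c : Fin n → F} :
    c ∈ gapCode F k a lam ↔ ∃ f ∈ gapPoly F k, (fun j => lam j * f.eval (a j)) = c := by
  simp [gapCode, Submodule.mem_map, funext_iff]

open Polynomial in
theorem le_finrank_gapPoly (k : ℕ) : k ≤ Module.finrank F (gapPoly F k) := by
  have h := LinearMap.finrank_range_add_finrank_ker
    ((lcoeff F (k - 1)).domRestrict (degreeLT F (k + 1)))
  have h1 : Module.finrank F (LinearMap.range
      ((lcoeff F (k - 1)).domRestrict (degreeLT F (k + 1)))) ≤ 1 := by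
    simpa using Submodule.finrank_le (LinearMap.range
      ((lcoeff F (k - 1)).domRestrict (degreeLT F (k + 1))))
  have h2 : Module.finrank F (degreeLT F (k + 1)) = k + 1 := by
    simpa using (degreeLTEquiv F (k + 1)).finrank_eq
  have h3 : Module.finrank F (LinearMap.ker
      ((lcoeff F (k - 1)).domRestrict (degreeLT F (k + 1)))) =
      Module.finrank F (gapPoly F k) := by
    rw [gapPoly, ← Submodule.map_comap_subtype, Submodule.finrank_map_subtype_eq]
    rfl
  omega

open Polynomial in
/-- A polynomial of degree at most `#s`, with vanishing coefficient of degree `#s - 1`, has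
vanishing weighted sum of values over a finite set `s` with sum zero. -/
theorem sum_eval_div_prod_eq_zero [DecidableEq F] {s : Finset F} (h0 : 0 < #s)
    (hs : ∑ x ∈ s, x = 0) {P : F[X]} (hP : P.natDegree ≤ #s) (hc : P.coeff (#s - 1) = 0) :
    ∑ x ∈ s, P.eval x / ∏ y ∈ s.erase x, (x - y) = 0 := by
  set N : F[X] := ∏ x ∈ s, (X - C x) with hN
  have hNd : N.natDegree = #s := by simp [hN]
  have hNm : N.Monic := monic_prod_X_sub_C _ _
  have hNc : N.coeff (#s - 1) = 0 := by
    have := prod_X_sub_C_nextCoeff (s := s) (fun x => x)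
    rw [nextCoeff_of_natDegree_pos (by rw [← hN, hNd]; exact h0), ← hN, hNd] at this
    simpa [hs] using this
  set R : F[X] := P - C (P.coeff #s) * N with hR
  have hRd : R.degree < #s := by
    rw [degree_lt_iff_coeff_zero]
    intro m hm
    rcases hm.eq_or_lt with rfl | hm
    · have : N.coeff #s = 1 := by rw [← hNd]; exact hNm
      simp [hR, this]
    · simp [hR, coeff_eq_zero_of_natDegree_lt (hP.trans_lt hm),
        coeff_eq_zero_of_natDegree_lt (hNd.trans_lt hm)]
  have hRc := Lagrange.coeff_eq_sum (s := s) (v := fun x : F => x) (fun _ _ _ _ h => h) hRd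
  have : R.coeff (#s - 1) = 0 := by simp [hR, hc, hNc]
  rw [← this, hRc]
  refine Finset.sum_congr rfl fun x hx => ?_
  have : N.eval x = 0 := by
    rw [hN, eval_prod]
    exact Finset.prod_eq_zero hx (by simp)
  simp [hR, this]

theorem finrank_dualCode {n : ℕ} (C : Submodule F (Fin n → F)) :
    Module.finrank F (dualCode C) = n - Module.finrank F C := by
  have hnd : (dotProductBilin F F : LinearMap.BilinForm F (Fin n → F)).Nondegenerate := by
    refine ⟨fun v h => dotProduct_eq_zero v h, fun v h => dotProduct_eq_zero v fun w => ?_⟩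
    rw [dotProduct_comm]
    exact h w
  have := LinearMap.BilinForm.finrank_orthogonal hnd C
  rw [Module.finrank_fin_fun] at this
  rw [← this]
  rfl

open Polynomial in
/-- A set of `n = k + k` points with sum zero and a `k`-subset with sum zero supports an NMDS
self-dual code, provided the weights `∏ y ∈ A.erase x, (x - y)` are all squares up to a common
factor. -/
theorem exists_isNMDS_selfDual [DecidableEq F] {n k : ℕ} (hn : n = k + k) (hk : 0 < k)
    {A A' : Finset F} (hA : #A = n) (hA' : A' ⊆ A) (hA'k : #A' = k)
    (hsum : ∑ x ∈ A, x = 0) (hsum' : ∑ x ∈ A', x = 0) {η : F} (hη : η ≠ 0)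
    (hsq : ∀ x ∈ A, IsSquare (η * ∏ y ∈ A.erase x, (x - y))) :
    ∃ C : Submodule F (Fin n → F), IsNMDSCode C ∧ C = dualCode C := by
  let e : Fin n ≃ A := (A.equivFinOfCardEq hA).symm
  have hprod : ∀ x : F, ∏ y ∈ A.erase x, (x - y) ≠ 0 := fun x =>
    Finset.prod_ne_zero_iff.2 fun y hy => sub_ne_zero.2 (Finset.ne_of_mem_erase hy).symm
  choose! μ hμ using hsq
  have hμ0 : ∀ x ∈ A, μ x ≠ 0 := fun x hx h => by
    have := hμ x hx
    rw [h, mul_zero] at this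
    exact mul_ne_zero hη (hprod x) this
  let a : Fin n → F := fun j => e j
  have haA : ∀ j, a j ∈ A := fun j => (e j).2
  have hinj : Function.Injective a := Subtype.val_injective.comp e.injective
  have hsumA : ∀ g : F → F, ∑ j, g (a j) = ∑ x ∈ A, g x := fun g => by
    rw [← Finset.sum_coe_sort A g]
    exact e.sum_comp fun x : A => g x
  have himg : Finset.univ.image a = A := by
    ext x
    simp only [Finset.mem_image, Finset.mem_univ, true_and]
    exact ⟨fun ⟨j, hj⟩ => hj ▸ haA j, fun hx => ⟨e.symm ⟨x, hx⟩, by simp [a]⟩⟩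
  let lam : Fin n → F := fun j => μ (a j) / ∏ y ∈ A.erase (a j), (a j - y)
  have hlam0 : ∀ j, lam j ≠ 0 := fun j => div_ne_zero (hμ0 _ (haA j)) (hprod _)
  have hlam : ∀ j, lam j * lam j = η / ∏ y ∈ A.erase (a j), (a j - y) := fun j => by
    have h1 := hprod (a j)
    have h2 := hμ _ (haA j)
    simp only [lam]
    rw [div_mul_div_comm, ← h2]
    field_simp
  have hzeros : ∀ f : F[X], (Finset.univ.filter fun j => lam j * f.eval (a j) = 0).card
      = #(A.filter fun x => f.eval x = 0) := fun f => by
    rw [← himg, Finset.filter_image, Finset.card_image_of_injective _ hinj]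
    simp [hlam0]
  have hwt : ∀ f : F[X], wt (fun j => lam j * f.eval (a j)) +
      #(A.filter fun x => f.eval x = 0) = n := fun f => by
    rw [← hzeros, wt, add_comm, Finset.card_filter_add_card_filter_not, Finset.card_univ,
      Fintype.card_fin]
  have hroots : ∀ f : F[X], f ≠ 0 → f.natDegree ≤ k →
      #(A.filter fun x => f.eval x = 0) ≤ k := fun f hf hd => by
    refine le_trans ?_ (le_trans (Polynomial.card_roots' f) hd)
    refine le_trans (Finset.card_le_card (t := f.roots.toFinset) fun x hx => ?_)
      (Multiset.toFinset_card_le _)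
    simpa [hf] using (Finset.mem_filter.1 hx).2
  let C := gapCode F k a lam
  have hle : C ≤ dualCode C := by
    intro c hc b hb
    obtain ⟨f, hf, rfl⟩ := mem_gapCode.1 hc
    obtain ⟨g, hg, rfl⟩ := mem_gapCode.1 hb
    obtain ⟨hf1, hf2⟩ := mem_gapPoly.1 hf
    obtain ⟨hg1, hg2⟩ := mem_gapPoly.1 hg
    have h1 : (g * f).natDegree ≤ #A :=
      natDegree_mul_le.trans (by omega)
    have h2 : (g * f).coeff (#A - 1) = 0 := by
      rw [coeff_mul]
      refine Finset.sum_eq_zero fun x hx => ?_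
      have hx := Finset.HasAntidiagonal.mem_antidiagonal.1 hx
      by_cases hx1 : k < x.1
      · rw [coeff_eq_zero_of_natDegree_lt (hg1.trans_lt hx1), zero_mul]
      by_cases hx2 : k < x.2
      · rw [coeff_eq_zero_of_natDegree_lt (hf1.trans_lt hx2), mul_zero]
      have : x.1 = k - 1 ∨ x.2 = k - 1 := by omega
      rcases this with h | h <;> simp [h, hf2, hg2]
    have h3 := sum_eval_div_prod_eq_zero (by omega) hsum h1 h2
    rw [← hsumA (fun x => (g * f).eval x / ∏ y ∈ A.erase x, (x - y))] at h3
    calc _ = ∑ j, η * ((g * f).eval (a j) / ∏ y ∈ A.erase (a j), (a j - y)) := by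
            refine Finset.sum_congr rfl fun j _ => ?_
            rw [eval_mul, mul_mul_mul_comm, hlam]
            ring
      _ = 0 := by rw [← Finset.mul_sum, h3, mul_zero]
  have hinjC : Function.Injective ((LinearMap.pi fun j => lam j • leval (a j) :
      F[X] →ₗ[F] (Fin n → F)).domRestrict (gapPoly F k)) := by
    rw [injective_iff_map_eq_zero]
    rintro ⟨f, hf⟩ h
    by_contra hne
    have hf0 : f ≠ 0 := fun h => hne (by simp [h])
    have h1 := hroots f hf0 (mem_gapPoly.1 hf).1
    have h2 : A.filter (fun x => f.eval x = 0) = A := by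
      refine Finset.filter_true_of_mem fun x hx => ?_
      obtain ⟨j, -, rfl⟩ := Finset.mem_image.1 (himg.symm ▸ hx)
      have := congrFun h j
      simpa [hlam0] using this
    rw [h2] at h1
    omega
  have hrank : k ≤ Module.finrank F C := by
    have h1 : C = LinearMap.range ((LinearMap.pi fun j => lam j • leval (a j) :
      F[X] →ₗ[F] (Fin n → F)).domRestrict (gapPoly F k)) := by
      rw [LinearMap.range_domRestrict]; rfl
    rw [h1, LinearMap.finrank_range_of_inj hinjC]
    exact le_finrank_gapPoly k
  have hdual := finrank_dualCode C
  have hle' := Submodule.finrank_mono hle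
  have hCn : Module.finrank F C ≤ n := by simpa using Submodule.finrank_le C
  have hself : C = dualCode C := Submodule.eq_of_le_of_finrank_le hle (by omega)
  have hrk : Module.finrank F C = k := by omega
  have hAMDS : IsAMDSCode C := by
    have hmin : minDist C = k := by
      refine le_antisymm (Nat.sInf_le ?_) ?_
      · let f : F[X] := ∏ x ∈ A', (X - Polynomial.C x)
        have hfd : f.natDegree = k := by simp [f, hA'k]
        have hfc : f.coeff (k - 1) = 0 := by
          have := prod_X_sub_C_nextCoeff (s := A') (fun x => x)
          rw [nextCoeff_of_natDegree_pos (by rw [hfd]; exact hk), hfd, hsum', neg_zero] at this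
          exact this
        have hfz : A.filter (fun x => f.eval x = 0) = A' := by
          ext x
          simp only [Finset.mem_filter, f, eval_prod, Finset.prod_eq_zero_iff, eval_sub, eval_X,
            eval_C, sub_eq_zero]
          exact ⟨fun ⟨_, y, hy, h⟩ => h ▸ hy, fun h => ⟨hA' h, x, h, rfl⟩⟩
        have hw := hwt f
        rw [hfz, hA'k] at hw
        refine ⟨_, mem_gapCode.2 ⟨f, mem_gapPoly.2 ⟨hfd.le, hfc⟩, rfl⟩, fun h => ?_, by omega⟩
        rw [h] at hw
        simp [wt] at hw
        omega
      · refine le_csInf ?_ ?_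
        · have : C ≠ ⊥ := fun h => by rw [h, finrank_bot] at hrk; omega
          obtain ⟨c, hc, hc0⟩ := Submodule.exists_mem_ne_zero_of_ne_bot this
          exact ⟨_, c, hc, hc0, rfl⟩
        · rintro _ ⟨c, hc, hc0, rfl⟩
          obtain ⟨f, hf, rfl⟩ := mem_gapCode.1 hc
          have hf0 : f ≠ 0 := fun h => hc0 (by ext; simp [h])
          have := hwt f
          have := hroots f hf0 (mem_gapPoly.1 hf).1
          omega
    rw [IsAMDSCode, hmin, hrk, hn]
  exact ⟨C, ⟨hAMDS, hself ▸ hAMDS⟩, hself⟩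

theorem eq_zero_of_add_self_eq_zero {G : Type*} [AddCommGroup G] (hG : Odd (Nat.card G)) {x : G}
    (hx : x + x = 0) : x = 0 := by
  have h := Nat.dvd_gcd (addOrderOf_dvd_of_nsmul_eq_zero ((two_nsmul x).trans hx))
    (addOrderOf_dvd_natCard x)
  rwa [(Nat.coprime_two_left.2 hG).gcd_eq_one, Nat.dvd_one, AddMonoid.addOrderOf_eq_one_iff] at h

theorem sum_univ_eq_zero_of_odd_card {G : Type*} [AddCommGroup G] [Fintype G]
    (hG : Odd (Nat.card G)) : ∑ x : G, x = 0 := by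
  refine eq_zero_of_add_self_eq_zero hG ?_
  have h : ∑ x : G, -x = ∑ x : G, x := Equiv.sum_comp (Equiv.neg G) fun x => x
  nth_rw 1 [← h]
  rw [Finset.sum_neg_distrib, neg_add_cancel]

/-- A finite abelian group of odd order has symmetric subsets of every even size that avoid
zero. -/
theorem exists_symm_finset {G : Type*} [AddCommGroup G] [Finite G] (hG : Odd (Nat.card G)) (j : ℕ)
    (hj : j + j < Nat.card G) :
    ∃ Q : Finset G, #Q = j + j ∧ 0 ∉ Q ∧ ∀ x ∈ Q, -x ∈ Q := by
  classical
  have := Fintype.ofFinite G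
  induction j with
  | zero => exact ⟨∅, by simp⟩
  | succ j ih =>
    obtain ⟨Q, hc, h0, hs⟩ := ih (by omega)
    obtain ⟨x, hx⟩ : ∃ x, x ∉ insert 0 Q := by
      by_contra! h
      have := Finset.card_le_card (fun x _ => h x : Finset.univ ⊆ insert 0 Q)
      rw [Finset.card_insert_of_notMem h0, Finset.card_univ, ← Nat.card_eq_fintype_card] at this
      omega
    rw [Finset.mem_insert, not_or] at hx
    have hne : x ≠ -x := fun h =>
      hx.1 (eq_zero_of_add_self_eq_zero hG (by nth_rw 2 [h]; exact add_neg_cancel x))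
    have hxn : -x ∉ Q := fun h => hx.2 (by simpa using hs _ h)
    refine ⟨insert x (insert (-x) Q), ?_, ?_, ?_⟩
    · rw [Finset.card_insert_of_notMem (by simp [hne, hx.2]), Finset.card_insert_of_notMem hxn, hc]
      omega
    · simp [h0, hx.1, Ne.symm hx.1, eq_comm]
    · intro y hy
      simp only [Finset.mem_insert] at hy ⊢
      rcases hy with rfl | rfl | hy
      · simp
      · simp
      · exact Or.inr (Or.inr (hs y hy))

/-- A union of cosets of `V` has sum zero in a group where `#V` times everything vanishes. -/
theorem sum_preimage_mk_eq_zero {G : Type*} [AddCommGroup G] [Fintype G]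
    (V : AddSubgroup G) [DecidableEq (G ⧸ V)] (hV : Odd (Nat.card V))
    (hG : ∀ x : G, Nat.card V • x = 0) (Q : Finset (G ⧸ V)) :
    ∑ x ∈ univ.filter fun x : G => (x : G ⧸ V) ∈ Q, x = 0 := by
  have := Fintype.ofFinite V
  rw [← Finset.sum_fiberwise_of_maps_to (s := univ.filter fun x : G => (x : G ⧸ V) ∈ Q)
    (t := Q) (g := fun x : G => (x : G ⧸ V)) (fun x hx => (Finset.mem_filter.1 hx).2)]
  refine Finset.sum_eq_zero fun q hq => ?_
  obtain ⟨g, rfl⟩ := QuotientAddGroup.mk_surjective q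
  have hsum : ∑ v : V, (g + v) = 0 := by
    rw [Finset.sum_add_distrib, Finset.sum_const, Finset.card_univ, ← Nat.card_eq_fintype_card, hG,
      zero_add, ← AddSubgroup.val_finsetSum,
      sum_univ_eq_zero_of_odd_card hV]
    rfl
  rw [← hsum]
  refine (Finset.sum_bij (fun (v : V) _ => g + (v : G)) ?_ ?_ ?_ ?_).symm
  · intro v _
    simp [hq]
  · intro v _ w _ h
    simpa using h
  · intro x hx
    have hx : (x : G ⧸ V) = g := (Finset.mem_filter.1 hx).2
    exact ⟨⟨-g + x, QuotientAddGroup.eq.1 hx.symm⟩, by simp⟩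
  · intro v _
    rfl

/-- Existence of a subgroup of order `p ^ c` together with a symmetric union of `j + j` of its
nontrivial cosets, half of which has sum zero. -/
theorem exists_addSubgroup_symm_cosets {G : Type*} [AddCommGroup G] [Finite G] {p m c j : ℕ}
    (hp : p.Prime) (hodd : Odd p) (hG : Nat.card G = p ^ m) (hpG : ∀ x : G, p • x = 0)
    (hc : 1 ≤ c) (hcm : c ≤ m) (hj : j + j < p ^ (m - c)) :
    ∃ (V : AddSubgroup G) (S S' : Finset G), Nat.card V = p ^ c ∧ S' ⊆ S ∧
      #S = (j + j) * p ^ c ∧ #S' = j * p ^ c ∧ ∑ x ∈ S', x = 0 ∧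
      (∀ x ∈ S, -x ∈ S) ∧ (∀ x ∈ S, ∀ v ∈ V, x + v ∈ S) ∧ ∀ v ∈ V, v ∉ S := by
  classical
  have := Fintype.ofFinite G
  have := Fact.mk hp
  obtain ⟨W, hW⟩ := Sylow.exists_subgroup_card_pow_prime (G := Multiplicative G) p (n := c)
    (by rw [Nat.card_congr Multiplicative.toAdd, hG]; exact pow_dvd_pow p hcm)
  let V : AddSubgroup G := Subgroup.toAddSubgroup' W
  have hV : Nat.card V = p ^ c := hW
  have hVG : ∀ x : G, Nat.card V • x = 0 := fun x => by
    obtain ⟨d, rfl⟩ := Nat.exists_eq_add_of_le' hc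
    rw [hV, pow_succ, mul_nsmul', hpG, nsmul_zero]
  have hQ : Nat.card (G ⧸ V) = p ^ (m - c) := by
    have h := V.card_eq_card_quotient_mul_card_addSubgroup
    rw [hG, hV, ← pow_sub_mul_pow p hcm] at h
    exact (Nat.eq_of_mul_eq_mul_right (pow_pos hp.pos c) h).symm
  obtain ⟨Q, hQc, hQ0, hQs⟩ := exists_symm_finset (G := G ⧸ V) (by rw [hQ]; exact hodd.pow) j
    (by rwa [hQ])
  obtain ⟨Q', hQ', hQ'c⟩ := Finset.exists_subset_card_eq (show j ≤ #Q by omega)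
  have hcard : ∀ R : Finset (G ⧸ V), #(univ.filter fun x : G => (x : G ⧸ V) ∈ R) =
      #R * p ^ c := fun R => by
    have h := Nat.card_congr
      (QuotientAddGroup.preimageMkEquivAddSubgroupProdSet V (R : Set (G ⧸ V)))
    rw [Nat.card_prod, hV, Nat.card_coe_set_eq, Nat.card_coe_set_eq, Set.ncard_coe_finset,
      mul_comm] at h
    rw [← h, ← Set.ncard_coe_finset]
    congr 1
    ext x
    simp
  refine ⟨V, univ.filter fun x : G => (x : G ⧸ V) ∈ Q, univ.filter fun x : G => (x : G ⧸ V) ∈ Q',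
    hV, ?_, ?_, ?_, sum_preimage_mk_eq_zero V (by rw [hV]; exact hodd.pow) hVG Q', ?_, ?_, ?_⟩
  · exact Finset.monotone_filter_right _ fun x _ h => hQ' h
  · rw [hcard, hQc]
  · rw [hcard, hQ'c]
  · intro x hx
    simpa using hQs _ (Finset.mem_filter.1 hx).2
  · intro x hx v hv
    have : ((v : G) : G ⧸ V) = 0 := (QuotientAddGroup.eq_zero_iff v).2 hv
    simpa [this] using hx
  · intro v hv
    have : ((v : G) : G ⧸ V) = 0 := (QuotientAddGroup.eq_zero_iff v).2 hv
    simpa [this] using hQ0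

/-- The additive group of the fixed points of an endomorphism. -/
def fixedPts (σ : F →+* F) : AddSubgroup F := (σ.toAddMonoidHom - AddMonoidHom.id F).ker

theorem mem_fixedPts {σ : F →+* F} {x : F} : x ∈ fixedPts σ ↔ σ x = x := by
  simp [fixedPts, AddMonoidHom.mem_ker, sub_eq_zero]

/-- In characteristic `p`, over a field with `(p ^ m) ^ 2` elements, the `p ^ m`-power map has
`p ^ m` fixed points and a nonzero anti-fixed point. -/
theorem card_fixedPts_iterateFrobenius [Fintype F] {p m : ℕ} [ExpChar F p]
    (hr : 1 < p ^ m) (hcard : Fintype.card F = (p ^ m) ^ 2) :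
    Nat.card (fixedPts (iterateFrobenius F p m)) = p ^ m ∧
      ∃ β : F, β ≠ 0 ∧ iterateFrobenius F p m β = -β := by
  classical
  set σ := iterateFrobenius F p m with hσ
  have hσd : ∀ x, σ x = x ^ p ^ m := fun x => iterateFrobenius_def p m x
  have hσσ : ∀ x, σ (σ x) = x := fun x => by
    rw [hσd, hσd, ← pow_mul, ← sq, ← hcard, FiniteField.pow_card]
  set φ : F →+ F := σ.toAddMonoidHom - AddMonoidHom.id F with hφ
  have hroots : ∀ ε : F, ∀ H : AddSubgroup F, (∀ x ∈ H, σ x = ε * x) → Nat.card H ≤ p ^ m := by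
    intro ε H hH
    have hd : (Polynomial.X ^ p ^ m - Polynomial.C ε * Polynomial.X : Polynomial F).natDegree
        = p ^ m := by
      rw [Polynomial.natDegree_sub_eq_left_of_natDegree_lt] <;> rw [Polynomial.natDegree_X_pow]
      exact (Polynomial.natDegree_C_mul_le ε _).trans_lt (by rwa [Polynomial.natDegree_X])
    have h0 : (Polynomial.X ^ p ^ m - Polynomial.C ε * Polynomial.X : Polynomial F) ≠ 0 := by
      intro h
      rw [h, Polynomial.natDegree_zero] at hd
      omega
    rw [← SetLike.coe_sort_coe, Nat.card_eq_fintype_card, ← Set.toFinset_card]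
    refine le_trans (Finset.card_le_card (fun x hx => ?_)) (le_trans (Multiset.toFinset_card_le _)
      ((Polynomial.card_roots' _).trans hd.le))
    have := hH x (by simpa using hx)
    rw [Multiset.mem_toFinset, Polynomial.mem_roots h0]
    simp [← hσd, this]
  have hker : Nat.card φ.ker ≤ p ^ m := hroots 1 φ.ker fun x hx => by
    rw [one_mul]; exact mem_fixedPts.1 hx
  have hanti : ∀ x ∈ φ.range, σ x = -x := by
    rintro _ ⟨x, rfl⟩
    simp [hφ, hσσ]
  have hrange : Nat.card φ.range ≤ p ^ m := hroots (-1) φ.range fun x hx => by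
    rw [neg_one_mul]; exact hanti x hx
  have hmul := φ.ker.card_mul_index
  rw [AddSubgroup.index_ker, Nat.card_eq_fintype_card (α := F), hcard] at hmul
  have h1 : Nat.card φ.ker = p ^ m := by nlinarith
  have h2 : Nat.card φ.range = p ^ m := by nlinarith
  refine ⟨h1, ?_⟩
  have : φ.range ≠ ⊥ := fun h => by
    rw [h, AddSubgroup.card_bot] at h2
    omega
  obtain ⟨β, hβ, hβ0⟩ := φ.range.bot_or_exists_ne_zero.resolve_left this
  exact ⟨β, hβ0, hanti β hβ⟩

theorem isSquare_of_pow_eq_self [Fintype F] {r : ℕ} (hr : Odd r)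
    (hcard : Fintype.card F = r ^ 2) {x : F} (hx : x ^ r = x) : IsSquare x := by
  rcases eq_or_ne x 0 with rfl | h0
  · exact IsSquare.zero
  have hF : ringChar F ≠ 2 := fun h => by
    have := (FiniteField.even_card_iff_char_two.1 h)
    rw [hcard] at this
    have := Nat.odd_iff.1 (hr.pow (n := 2))
    omega
  rw [FiniteField.isSquare_iff hF h0, hcard]
  obtain ⟨d, rfl⟩ := hr
  have : (2 * d + 1) ^ 2 / 2 = (2 * d) * (d + 1) := by
    have : (2 * d + 1) ^ 2 = 2 * ((2 * d) * (d + 1)) + 1 := by ring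
    omega
  have h1 : x ^ (2 * d) = 1 := mul_right_cancel₀ h0 (by rw [← pow_succ, hx, one_mul])
  rw [this, pow_mul, h1, one_pow]

/-- The point `x.1 * β + x.2` of the plane over the fixed points of `σ`. -/
def planePt (σ : F →+* F) (β : F) (x : fixedPts σ × fixedPts σ) : F := x.1 * β + x.2

theorem planePt_injective {σ : F →+* F} {β : F} (h2 : (2 : F) ≠ 0) (hβ0 : β ≠ 0)
    (hβ : σ β = -β) : Function.Injective (planePt σ β) := by
  intro x y h
  have h' := congrArg σ h
  have hσ : ∀ z : fixedPts σ, σ z = z := fun z => mem_fixedPts.1 z.2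
  simp only [planePt, map_add, map_mul, hσ, hβ] at h h'
  refine Prod.ext (Subtype.ext ?_) (Subtype.ext ?_)
  · refine mul_right_cancel₀ (mul_ne_zero h2 hβ0) ?_
    linear_combination h - h'
  · refine mul_right_cancel₀ h2 ?_
    linear_combination h + h'

theorem map_prod_univ_sub_eq_neg {σ : F →+* F} [Fintype (fixedPts σ)]
    (hodd : Odd (Nat.card (fixedPts σ))) {β : F} (hβ : σ β = -β)
    (x : fixedPts σ × fixedPts σ) (y : fixedPts σ) :
    σ (∏ u, (planePt σ β x - planePt σ β (y, u))) =
      -∏ u, (planePt σ β x - planePt σ β (y, u)) := by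
  have hσ : ∀ z : fixedPts σ, σ z = z := fun z => mem_fixedPts.1 z.2
  have h1 : ∏ u, (planePt σ β x - planePt σ β (y, u)) = ∏ u : fixedPts σ, ((x.1 - y) * β + u) := by
    rw [← (Equiv.subLeft x.2).prod_comp]
    refine Finset.prod_congr rfl fun u _ => ?_
    simp only [planePt, Equiv.subLeft_apply, AddSubgroup.coe_sub]
    ring
  rw [h1, map_prod]
  calc ∏ u : fixedPts σ, σ ((x.1 - y) * β + u)
      = ∏ u : fixedPts σ, -((x.1 - y) * β + (-u : fixedPts σ)) := by
        refine Finset.prod_congr rfl fun u _ => ?_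
        simp only [map_add, map_mul, map_sub, hσ, hβ, AddSubgroup.coe_neg]
        ring
    _ = ∏ u : fixedPts σ, -((x.1 - y) * β + u) :=
        Equiv.prod_comp (Equiv.neg (fixedPts σ)) fun u : fixedPts σ => -((x.1 - y) * β + (u : F))
    _ = _ := by
        rw [Finset.prod_neg, Finset.card_univ, ← Nat.card_eq_fintype_card, hodd.neg_one_pow,
          neg_one_mul]

/-- The union of the lines `{y} × K`, `y ∈ T`, and of the points `(v, 0)`, `v ∈ S`. -/
def linesPts {K : Type*} [AddCommGroup K] [Fintype K] [DecidableEq K] (T S : Finset K) :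
    Finset (K × K) :=
  T ×ˢ univ ∪ S ×ˢ {0}

theorem disjoint_lines_pts {K : Type*} [AddCommGroup K] [Fintype K] {T S : Finset K}
    (h : Disjoint T S) : Disjoint (T ×ˢ (univ : Finset K)) (S ×ˢ {0}) :=
  Finset.disjoint_product.2 (Or.inl h)

theorem card_linesPts {K : Type*} [AddCommGroup K] [Fintype K] [DecidableEq K] {T S : Finset K}
    (h : Disjoint T S) : #(linesPts T S) = #T * Nat.card K + #S := by
  rw [linesPts, Finset.card_union_of_disjoint (disjoint_lines_pts h), Finset.card_product,
    Finset.card_product, Finset.card_singleton, mul_one, Finset.card_univ,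
    Nat.card_eq_fintype_card]

theorem sum_linesPts_planePt {σ : F →+* F} [Fintype (fixedPts σ)] [DecidableEq (fixedPts σ)]
    (hodd : Odd (Nat.card (fixedPts σ))) (hK : (Nat.card (fixedPts σ) : F) = 0) (β : F)
    {T S : Finset (fixedPts σ)} (h : Disjoint T S) (hS : ∑ x ∈ S, x = 0) :
    ∑ x ∈ linesPts T S, planePt σ β x = 0 := by
  have h1 : ∑ u : fixedPts σ, (u : F) = 0 := by
    rw [← AddSubgroup.val_finsetSum, sum_univ_eq_zero_of_odd_card hodd, AddSubgroup.coe_zero]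
  have h2 : ∑ x ∈ S, (x : F) = 0 := by
    rw [← AddSubgroup.val_finsetSum, hS, AddSubgroup.coe_zero]
  have hK' : (Fintype.card (fixedPts σ) : F) = 0 := by rwa [← Nat.card_eq_fintype_card]
  rw [linesPts, Finset.sum_union (disjoint_lines_pts h), Finset.sum_product, Finset.sum_product]
  simp [planePt, Finset.sum_add_distrib, h1, h2, hK', ← Finset.sum_mul]

theorem map_prod_erase_linesPts {σ : F →+* F} [Fintype (fixedPts σ)] [DecidableEq (fixedPts σ)]
    (hodd : Odd (Nat.card (fixedPts σ))) {β : F} (hβ : σ β = -β) {V : AddSubgroup (fixedPts σ)}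
    {T S : Finset (fixedPts σ)} (hT : ∀ y ∈ T, y ∈ V) (hTe : Even #T) (hSe : Even #S)
    (hSneg : ∀ x ∈ S, -x ∈ S) (hSV : ∀ x ∈ S, ∀ v ∈ V, x + v ∈ S) (hTS : Disjoint T S)
    {x : fixedPts σ × fixedPts σ} (hx : x ∈ linesPts T S) :
    σ (∏ z ∈ (linesPts T S).erase x, (planePt σ β x - planePt σ β z)) =
      -∏ z ∈ (linesPts T S).erase x, (planePt σ β x - planePt σ β z) := by
  have hσ : ∀ z : fixedPts σ, σ z = z := fun z => mem_fixedPts.1 z.2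
  have hlines : ∀ R : Finset (fixedPts σ),
      σ (∏ z ∈ R ×ˢ univ, (planePt σ β x - planePt σ β z)) =
        (-1) ^ #R * ∏ z ∈ R ×ˢ univ, (planePt σ β x - planePt σ β z) := fun R => by
    rw [Finset.prod_product, map_prod, ← Finset.prod_neg]
    exact Finset.prod_congr rfl fun y _ => map_prod_univ_sub_eq_neg hodd hβ x y
  obtain ⟨y₀, u₀⟩ := x
  rcases Finset.mem_union.1 hx with hx | hx
  · have hy : y₀ ∈ T := (Finset.mem_product.1 hx).1
    have hsplit : (linesPts T S).erase (y₀, u₀) =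
        ((T.erase y₀ ×ˢ univ) ∪ ({y₀} ×ˢ univ.erase u₀)) ∪ S ×ˢ {0} := by
      ext ⟨y, u⟩
      have hyS : y₀ ∉ S := Finset.disjoint_left.1 hTS hy
      simp only [linesPts, Finset.mem_erase, Finset.mem_union, Finset.mem_product,
        Finset.mem_univ, Finset.mem_singleton, ne_eq, Prod.mk.injEq, and_true]
      by_cases h : y = y₀
      · subst h; simp [hy, hyS]
      · simp [h]
    have hd1 : Disjoint (T.erase y₀ ×ˢ (univ : Finset (fixedPts σ))) ({y₀} ×ˢ univ.erase u₀) :=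
      Finset.disjoint_product.2 (Or.inl (by simp))
    have hd2 : Disjoint ((T.erase y₀ ×ˢ univ) ∪ ({y₀} ×ˢ univ.erase u₀)) (S ×ˢ {0}) := by
      refine (disjoint_lines_pts hTS).mono_left (Finset.union_subset ?_ ?_)
      · exact Finset.product_subset_product_left (Finset.erase_subset _ _)
      · exact Finset.product_subset_product (by simpa using hy) (Finset.subset_univ _)
    have h2 : σ (∏ z ∈ {y₀} ×ˢ univ.erase u₀, (planePt σ β (y₀, u₀) - planePt σ β z)) =
        ∏ z ∈ {y₀} ×ˢ univ.erase u₀, (planePt σ β (y₀, u₀) - planePt σ β z) := by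
      rw [Finset.prod_product, Finset.prod_singleton, map_prod]
      refine Finset.prod_congr rfl fun u _ => ?_
      simp [planePt, hσ]
    have h3 : σ (∏ z ∈ S ×ˢ {0}, (planePt σ β (y₀, u₀) - planePt σ β z)) =
        ∏ z ∈ S ×ˢ {0}, (planePt σ β (y₀, u₀) - planePt σ β z) := by
      simp only [Finset.prod_product, Finset.prod_singleton, map_prod]
      have hmem : ∀ v ∈ S, -v + (y₀ + y₀) ∈ S := fun v hv =>
        hSV _ (hSneg v hv) _ (V.add_mem (hT _ hy) (hT _ hy))
      refine Finset.prod_bij' (fun v _ => -v + (y₀ + y₀)) (fun v _ => -v + (y₀ + y₀)) hmem hmem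
        (fun v _ => by abel) (fun v _ => by abel) fun v _ => ?_
      simp only [planePt, map_sub, map_add, map_mul, hσ, hβ, AddSubgroup.coe_add,
        AddSubgroup.coe_neg]
      ring
    have hcard : Odd #(T.erase y₀) := by
      rw [Finset.card_erase_of_mem hy]
      exact Nat.Even.sub_odd (Finset.card_pos.2 ⟨_, hy⟩) hTe odd_one
    rw [hsplit, Finset.prod_union hd2, Finset.prod_union hd1, map_mul, map_mul, hlines, h2, h3,
      hcard.neg_one_pow]
    ring
  · obtain ⟨hv, rfl⟩ : y₀ ∈ S ∧ u₀ = 0 := by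
      rwa [Finset.mem_product, Finset.mem_singleton] at hx
    have hsplit : (linesPts T S).erase (y₀, 0) = T ×ˢ univ ∪ S.erase y₀ ×ˢ {0} := by
      ext ⟨y, u⟩
      have hyT : y₀ ∉ T := Finset.disjoint_right.1 hTS hv
      simp only [linesPts, Finset.mem_erase, Finset.mem_union, Finset.mem_product,
        Finset.mem_univ, Finset.mem_singleton, ne_eq, Prod.mk.injEq, and_true]
      by_cases h : y = y₀
      · subst h; simp [hyT]
        tauto
      · simp [h]
    have hd : Disjoint (T ×ˢ (univ : Finset (fixedPts σ))) (S.erase y₀ ×ˢ {0}) :=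
      disjoint_lines_pts (hTS.mono_right (Finset.erase_subset _ _))
    have h2 : σ (∏ z ∈ S.erase y₀ ×ˢ {0}, (planePt σ β (y₀, 0) - planePt σ β z)) =
        -∏ z ∈ S.erase y₀ ×ˢ {0}, (planePt σ β (y₀, 0) - planePt σ β z) := by
      have hcard : Odd #(S.erase y₀) := by
        rw [Finset.card_erase_of_mem hv]
        exact Nat.Even.sub_odd (Finset.card_pos.2 ⟨_, hv⟩) hSe odd_one
      simp only [Finset.prod_product, Finset.prod_singleton, map_prod]
      rw [← neg_one_mul, ← hcard.neg_one_pow, ← Finset.prod_neg]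
      refine Finset.prod_congr rfl fun v _ => ?_
      simp only [planePt, map_sub, map_add, map_mul, hσ, hβ]
      simp
      ring
    rw [hsplit, Finset.prod_union hd, map_mul, hlines, h2, hTe.neg_one_pow]
    ring

/-- for q = r² with r = p^m, p an odd prime, even t and s with
1 ≤ t ≤ r, 0 ≤ s ≤ p^{m-t'} - 1 where t' = ⌈log_p t⌉, there is a q-ary NMDS
self-dual code of length n = t·r + s·p^{t'}. -/
theorem stmt14 (p m t s : ℕ) (hp : p.Prime) (hodd : Odd p)
    [Fintype F] [DecidableEq F] (hcard : Fintype.card F = (p ^ m) ^ 2)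
    (ht : Even t) (hs : Even s) (ht1 : 1 ≤ t) (ht2 : t ≤ p ^ m)
    (hs2 : s ≤ p ^ (m - Nat.clog p t) - 1) :
    ∃ C : Submodule F (Fin (t * p ^ m + s * p ^ Nat.clog p t) → F),
      IsNMDSCode C ∧ C = dualCode C := by
  classical
  obtain ⟨i, rfl⟩ := ht
  obtain ⟨j, rfl⟩ := hs
  have := Fact.mk hp
  have hr : 1 < p ^ m := by omega
  have hm : m ≠ 0 := by rintro rfl; simp at hr
  have : CharP F p := charP_of_card_eq_prime_pow (f := m * 2) (by rw [hcard, pow_mul])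
  have hpF : (p : F) = 0 := CharP.cast_eq_zero F p
  have h2 : (2 : F) ≠ 0 := by
    intro h
    have h := (CharP.cast_eq_zero_iff F p 2).1 (by exact_mod_cast h)
    have := (Nat.prime_dvd_prime_iff_eq hp Nat.prime_two).1 h
    subst this
    exact absurd hodd (by decide)
  obtain ⟨hK, β, hβ0, hβ⟩ := card_fixedPts_iterateFrobenius (F := F) hr hcard
  set σ := iterateFrobenius F p m with hσ
  have hKodd : Odd (Nat.card (fixedPts σ)) := by rw [hK]; exact hodd.pow
  have hK0 : (Nat.card (fixedPts σ) : F) = 0 := by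
    rw [hK, Nat.cast_pow, hpF, zero_pow hm]
  have := Fintype.ofFinite (fixedPts σ)
  set c := Nat.clog p (i + i) with hc
  have hc1 : 1 ≤ c := Nat.clog_pos hp.one_lt (by omega)
  have hcm : c ≤ m := (Nat.clog_le_iff_le_pow hp.one_lt).2 ht2
  have htc : i + i ≤ p ^ c := Nat.le_pow_clog hp.one_lt _
  obtain ⟨V, S, S', hV, hS', hSc, hS'c, hS'0, hSneg, hSV, hVS⟩ :=
    exists_addSubgroup_symm_cosets (G := fixedPts σ) (j := j) hp hodd hK
      (fun x => Subtype.ext (by simp)) hc1 hcm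
      (by have := pow_pos hp.pos (m - c); omega)
  have hVc : #(univ.filter (· ∈ V)) = p ^ c := by
    rw [← hV, Nat.card_eq_fintype_card, Fintype.card_subtype]
  obtain ⟨T, hT, hTc⟩ := Finset.exists_subset_card_eq (htc.trans hVc.ge)
  obtain ⟨T', hT', hT'c⟩ := Finset.exists_subset_card_eq (show i ≤ #T by omega)
  have hTV : ∀ y ∈ T, y ∈ V := fun y hy => (Finset.mem_filter.1 (hT hy)).2
  have hTS : Disjoint T S := Finset.disjoint_left.2 fun y hy => hVS y (hTV y hy)
  have hTS' : Disjoint T' S' := hTS.mono hT' hS'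
  have hS0 : ∑ x ∈ S, x = 0 := by
    refine eq_zero_of_add_self_eq_zero hKodd ?_
    have h : ∑ x ∈ S, -x = ∑ x ∈ S, x :=
      Finset.sum_nbij' (fun x => -x) (fun x => -x) hSneg hSneg (by simp) (by simp) (by simp)
    nth_rw 1 [← h]
    rw [Finset.sum_neg_distrib, neg_add_cancel]
  have hinj := planePt_injective h2 hβ0 hβ
  have hsub : linesPts T' S' ⊆ linesPts T S :=
    Finset.union_subset_union (Finset.product_subset_product_left hT')
      (Finset.product_subset_product_left hS')
  refine exists_isNMDS_selfDual (k := i * p ^ m + j * p ^ c) (by ring)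
    (Nat.add_pos_left (Nat.mul_pos (by omega) (by omega)) _)
    (A := (linesPts T S).image (planePt σ β)) (A' := (linesPts T' S').image (planePt σ β))
    ?_ (Finset.image_subset_image hsub) ?_ ?_ ?_ hβ0 ?_
  · rw [Finset.card_image_of_injective _ hinj, card_linesPts hTS, hTc, hSc, hK]
  · rw [Finset.card_image_of_injective _ hinj, card_linesPts hTS', hT'c, hS'c, hK]
  · rw [Finset.sum_image hinj.injOn]
    exact sum_linesPts_planePt hKodd hK0 β hTS hS0
  · rw [Finset.sum_image hinj.injOn]
    exact sum_linesPts_planePt hKodd hK0 β hTS' hS'0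
  · intro a ha
    obtain ⟨x, hx, rfl⟩ := Finset.mem_image.1 ha
    rw [← Finset.image_erase hinj, Finset.prod_image hinj.injOn]
    refine isSquare_of_pow_eq_self hodd.pow hcard ?_
    rw [← iterateFrobenius_def, ← hσ, map_mul, hβ, map_prod_erase_linesPts hKodd hβ hTV
      (by rw [hTc]; exact Even.add_self i) (by rw [hSc]; exact (Even.add_self j).mul_right _)
      hSneg hSV hTS hx, neg_mul_neg]

end
end

section
/- Let r be an odd prime power, q = r^2, let α be a generator of the multiplicative group F_q^*, and set β = α^{r-1}. Then for every integer i such that β^{2i} ≠ 1, one has (1 - β^{2i})^{r-1} = -β^{-2i}. -/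
open Finset

noncomputable section

variable {F : Type} [Field F]

/-- In a finite field with `r ^ 2` elements, `x ↦ x ^ r` respects subtraction. -/
theorem sub_pow_of_card_eq_sq {K : Type*} [Field K] [Fintype K] {r : ℕ} (hr : IsPrimePow r)
    (hcard : Fintype.card K = r ^ 2) (x y : K) : (x - y) ^ r = x ^ r - y ^ r := by
  obtain ⟨p, k, hp, -, rfl⟩ := hr
  have : Fact p.Prime := ⟨hp.nat_prime⟩
  have hp0 : (p : K) = 0 := by
    have h : ((Fintype.card K : ℕ) : K) = 0 := Nat.cast_card_eq_zero K
    rw [hcard] at h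
    push_cast at h
    exact eq_zero_of_pow_eq_zero (eq_zero_of_pow_eq_zero h)
  have : CharP K p := ringChar.of_eq (CharP.ringChar_of_prime_eq_zero hp.nat_prime hp0)
  exact sub_pow_char_pow x y k

/-- If `x ↦ x ^ r` respects `1 - x` and `x ^ (r + 1) = 1`, then `(1 - x) ^ (r - 1) = -x⁻¹`. -/
theorem one_sub_pow_pred_eq_neg_inv {K : Type*} [Field K] {r : ℕ} (hr : r ≠ 0) {x : K}
    (hx : x ≠ 1) (hfrob : (1 - x) ^ r = 1 - x ^ r) (hpow : x ^ (r + 1) = 1) :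
    (1 - x) ^ (r - 1) = -x⁻¹ := by
  have hx0 : x ≠ 0 := by
    rintro rfl
    simp at hpow
  have hinv : x ^ r = x⁻¹ := eq_inv_of_mul_eq_one_left (by rw [← pow_succ, hpow])
  apply mul_right_cancel₀ (sub_ne_zero.mpr hx.symm)
  rw [pow_sub_one_mul hr, hfrob, hinv]
  field_simp
  ring

/-- for q = r², α a generator of F_q^*, β = α^{r-1}, and any integer i
with β^{2i} ≠ 1, one has (1 - β^{2i})^{r-1} = -β^{-2i}. -/
theorem stmt15 (r : ℕ) (hr : IsPrimePow r) (hodd : Odd r)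
    [Fintype F] (hcard : Fintype.card F = r ^ 2)
    (α : Fˣ) (hα : ∀ x : Fˣ, x ∈ Subgroup.zpowers α)
    (β : Fˣ) (hβ : β = α ^ (r - 1))
    (i : ℤ) (hi : β ^ (2 * i) ≠ 1) :
    ((1 : F) - ((β ^ (2 * i) : Fˣ) : F)) ^ (r - 1) = -((β ^ (-(2 * i)) : Fˣ) : F) := by
  have hr0 : r ≠ 0 := hr.ne_zero
  have hβ1 : β ^ (r + 1) = 1 := by
    have hmul : (r - 1) * (r + 1) = Nat.card Fˣ := by
      rw [Nat.card_units, Nat.card_eq_fintype_card, hcard, mul_comm, ← Nat.sq_sub_sq, one_pow]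
    rw [hβ, ← pow_mul, hmul, pow_card_eq_one']
  have hpow : (β ^ (2 * i)) ^ (r + 1) = 1 := by
    rw [← zpow_natCast, zpow_comm, zpow_natCast, hβ1, one_zpow]
  rw [zpow_neg, Units.val_inv_eq_inv_val]
  refine one_sub_pow_pred_eq_neg_inv hr0 (by simpa only [ne_eq, Units.val_eq_one] using hi) ?_ ?_
  · rw [sub_pow_of_card_eq_sq hr hcard, one_pow]
  · rw [← Units.val_pow_eq_pow_val, hpow, Units.val_one]

end
end
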